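/- There exists a set X ⊆ ℕ that is high for tight descending sequences but not uniformly high for tight descending sequences. -/

import Mathlib

namespace CFT

open Nat.Partrec (Code)

/-- Relativized partial recursive functions: `f` is partial recursive in the
(total) oracle `O : ℕ → ℕ`.  This mirrors Mathlib's `Nat.Partrec`, with an
extra constructor for the oracle. -/
inductive RecursiveIn (O : ℕ → ℕ) : (ℕ →. ℕ) → Prop
  | zero : RecursiveIn O (pure 0)
  | succ : RecursiveIn O Nat.succ
  | left : RecursiveIn O ↑fun n : ℕ => n.unpair.1
  | right : RecursiveIn O ↑fun n : ℕ => n.unpair.2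
  | oracle : RecursiveIn O ↑O
  | pair {f g} : RecursiveIn O f → RecursiveIn O g →
      RecursiveIn O fun n => Nat.pair <$> f n <*> g n
  | comp {f g} : RecursiveIn O f → RecursiveIn O g →
      RecursiveIn O fun n => g n >>= f
  | prec {f g} : RecursiveIn O f → RecursiveIn O g →
      RecursiveIn O (Nat.unpaired fun a n =>
        n.rec (f a) fun y IH => do let i ← IH; g (Nat.pair a (Nat.pair y i)))
  | rfind {f} : RecursiveIn O f →
      RecursiveIn O fun a => Nat.rfind fun n => (fun m => m = 0) <$> f (Nat.pair a n)

/-- Partial functions between `Primcodable` types that are partial recursive in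
the oracle `O`. -/
def PartrecIn (O : ℕ → ℕ) {α σ : Type} [Primcodable α] [Primcodable σ] (f : α →. σ) : Prop :=
  RecursiveIn O fun n =>
    Part.bind (Part.ofOption (Encodable.decode (α := α) n)) fun a => (f a).map Encodable.encode

/-- Total functions between `Primcodable` types that are computable in the oracle `O`. -/
def ComputableIn (O : ℕ → ℕ) {α σ : Type} [Primcodable α] [Primcodable σ] (f : α → σ) : Prop :=
  PartrecIn O (f : α →. σ)

open Classical in
/-- The characteristic function of a set of naturals. -/
noncomputable def chi (A : Set ℕ) : ℕ → ℕ := fun n => if n ∈ A then 1 else 0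

/-- `A` is computably enumerable in (the characteristic function of) `X`. -/
def CEIn (X : Set ℕ) (A : Set ℕ) : Prop :=
  ∃ f : ℕ →. ℕ, PartrecIn (chi X) f ∧ ∀ n, n ∈ A ↔ (f n).Dom

/-- The `e`-th partial computable function `ℕ →. ℕ`. -/
def codeFn (e : ℕ) : ℕ →. ℕ := (Denumerable.ofNat Code e).eval

/-! ### Trees on ℕ -/

def PrefixClosed (T : Set (List ℕ)) : Prop := ∀ l ∈ T, ∀ l' : List ℕ, l' <+: l → l' ∈ T

/-- Index `e` decides a (prefix-closed) tree on `ℕ`. -/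
def DecidesTree (e : ℕ) : Prop :=
  (∀ n, (codeFn e n).Dom) ∧
    PrefixClosed {l : List ℕ | codeFn e (Encodable.encode l) = Part.some 1}

open Classical in
/-- The standard enumeration of computable trees on ℕ; indices that do not
decide a tree denote the empty tree. -/
noncomputable def treeAt (e : ℕ) : Set (List ℕ) :=
  if DecidesTree e then {l : List ℕ | codeFn e (Encodable.encode l) = Part.some 1} else ∅

/-- `f` is a path through the tree `T`: every finite initial segment
`[f 0, …, f (k-1)]` is in `T`. -/
def IsPath (T : Set (List ℕ)) (f : ℕ → ℕ) : Prop := ∀ k, (List.range k).map f ∈ T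

def IllFounded (T : Set (List ℕ)) : Prop := ∃ f, IsPath T f

/-- The set of indices of well-founded computable trees. -/
def WF : Set ℕ := {e | ¬ IllFounded (treeAt e)}

/-- `T` is a computable tree (prefix-closed and decided by a total computable function). -/
def ComputableTree (T : Set (List ℕ)) : Prop :=
  PrefixClosed T ∧ ∃ χ : List ℕ → Bool, Computable χ ∧ ∀ l, l ∈ T ↔ χ l = true

/-! ### Highness notions for paths -/

def HighForPaths (X : Set ℕ) : Prop :=
  ∀ T : Set (List ℕ), ComputableTree T → IllFounded T →
    ∃ f : ℕ → ℕ, ComputableIn (chi X) f ∧ IsPath T f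

def LoqHighForPaths (X : Set ℕ) : Prop :=
  ∃ F : ℕ × ℕ → ℕ, ComputableIn (chi X) F ∧
    ∀ e, IllFounded (treeAt e) → IsPath (treeAt e) fun n => F (e, n)

def UnifHighForPaths (X : Set ℕ) : Prop :=
  ∃ F : ℕ × ℕ →. ℕ, PartrecIn (chi X) F ∧
    ∀ e, IllFounded (treeAt e) →
      ∃ g : ℕ → ℕ, IsPath (treeAt e) g ∧ ∀ n, F (e, n) = Part.some (g n)

def RetHighForPaths (X : Set ℕ) : Prop :=
  ∃ F : ℕ × ℕ →. ℕ, PartrecIn (chi X) F ∧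
    (∀ e, IllFounded (treeAt e) →
      ∃ g : ℕ → ℕ, IsPath (treeAt e) g ∧ ∀ n, F (e, n) = Part.some (g n)) ∧
    (∀ e, ¬ IllFounded (treeAt e) → ∀ n, ¬ (F (e, n)).Dom)

/-! ### Σ¹₁ and Π¹₁ sets -/

def Sigma11 (A : Set ℕ) : Prop :=
  ∃ R : ℕ → List ℕ → Bool, Computable₂ R ∧
    ∀ n, n ∈ A ↔ ∃ f : ℕ → ℕ, ∀ k, R n ((List.range k).map f) = true

def Pi11 (A : Set ℕ) : Prop := Sigma11 Aᶜ

/-! ### Linear orders -/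

/-- A (presentation of a) linear order: a domain `D ⊆ ℕ` and a strict order
relation on it. -/
structure LinOrd where
  dom : Set ℕ
  lt : ℕ → ℕ → Prop

/-- `L` really is a strict linear order on its domain. -/
def LinOrd.IsValid (L : LinOrd) : Prop :=
  (∀ a b, L.lt a b → a ∈ L.dom ∧ b ∈ L.dom) ∧
  (∀ a, ¬ L.lt a a) ∧
  (∀ a b c, L.lt a b → L.lt b c → L.lt a c) ∧
  (∀ a ∈ L.dom, ∀ b ∈ L.dom, a = b ∨ L.lt a b ∨ L.lt b a)

def linOrdOfCodes (n : ℕ) : LinOrd :=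
  ⟨{a | codeFn n.unpair.1 a = Part.some 1},
   fun a b => codeFn n.unpair.2 (Nat.pair a b) = Part.some 1⟩

def DecidesLinOrd (n : ℕ) : Prop :=
  (∀ m, (codeFn n.unpair.1 m).Dom) ∧ (∀ m, (codeFn n.unpair.2 m).Dom) ∧
    (linOrdOfCodes n).IsValid

open Classical in
/-- The standard enumeration of computable linear orders; indices that do not
decide a linear order denote the empty order. -/
noncomputable def linOrdAt (n : ℕ) : LinOrd :=
  if DecidesLinOrd n then linOrdOfCodes n else ⟨∅, fun _ _ => False⟩

def IsDescSeq (L : LinOrd) (f : ℕ → ℕ) : Prop :=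
  ∀ i, f i ∈ L.dom ∧ L.lt (f (i + 1)) (f i)

def LinOrd.IllFounded (L : LinOrd) : Prop := ∃ f, IsDescSeq L f

/-- A tight descending sequence: a descending sequence that gets below every
descending sequence. -/
def IsTightDescSeq (L : LinOrd) (f : ℕ → ℕ) : Prop :=
  IsDescSeq L f ∧ ∀ g, IsDescSeq L g → ∀ n, ∃ m, L.lt (f m) (g n)

/-- `L` is a computable linear order. -/
def ComputableLinOrd (L : LinOrd) : Prop :=
  L.IsValid ∧
  (∃ χ : ℕ → Bool, Computable χ ∧ ∀ a, a ∈ L.dom ↔ χ a = true) ∧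
  (∃ χ : ℕ → ℕ → Bool, Computable₂ χ ∧ ∀ a b, L.lt a b ↔ χ a b = true)

def LoqHighForDS (X : Set ℕ) : Prop :=
  ∃ g : ℕ × ℕ → ℕ, ComputableIn (chi X) g ∧
    ∀ n, (linOrdAt n).IllFounded → IsDescSeq (linOrdAt n) fun k => g (n, k)

def HighForTightDS (X : Set ℕ) : Prop :=
  ∀ L : LinOrd, ComputableLinOrd L → L.IllFounded →
    ∃ f : ℕ → ℕ, ComputableIn (chi X) f ∧ IsTightDescSeq L f

def UnifHighForTightDS (X : Set ℕ) : Prop :=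
  ∃ F : ℕ × ℕ →. ℕ, PartrecIn (chi X) F ∧
    ∀ n, (linOrdAt n).IllFounded →
      ∃ g : ℕ → ℕ, IsTightDescSeq (linOrdAt n) g ∧ ∀ k, F (n, k) = Part.some (g k)

/-! ### Binary trees -/

def PrefixClosedB (B : Set (List Bool)) : Prop := ∀ l ∈ B, ∀ l' : List Bool, l' <+: l → l' ∈ B

def DecidesBTree (e : ℕ) : Prop :=
  (∀ n, (codeFn e n).Dom) ∧
    PrefixClosedB {l : List Bool | codeFn e (Encodable.encode l) = Part.some 1}

open Classical in
/-- The standard enumeration of computable binary trees; indices that do not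
decide a binary tree denote the full binary tree. -/
noncomputable def bTreeAt (e : ℕ) : Set (List Bool) :=
  if DecidesBTree e then {l : List Bool | codeFn e (Encodable.encode l) = Part.some 1}
  else Set.univ

def BInfinite (B : Set (List Bool)) : Prop := ∀ k, ∃ l ∈ B, l.length = k

def IsBPath (B : Set (List Bool)) (p : ℕ → Bool) : Prop := ∀ k, (List.range k).map p ∈ B

section

attribute [fun_prop] Computable
attribute [fun_prop] Computable.id Computable.const Computable.comp Computable.pair
  Computable.fst Computable.snd

section FunProp

variable {α β γ δ : Type} [Primcodable α] [Primcodable β] [Primcodable γ] [Primcodable δ]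

@[fun_prop]
theorem computable_unpair : Computable Nat.unpair := Computable.unpair

@[fun_prop]
theorem computable_natPair {f g : α → ℕ} (hf : Computable f) (hg : Computable g) :
    Computable fun a => Nat.pair (f a) (g a) :=
  Primrec₂.natPair.to_comp.comp hf hg

@[fun_prop]
theorem computable_add {f g : α → ℕ} (hf : Computable f) (hg : Computable g) :
    Computable fun a => f a + g a :=
  Primrec.nat_add.to_comp.comp hf hg

@[fun_prop]
theorem computable_decide_eq [DecidableEq β] {f g : α → β} (hf : Computable f)
    (hg : Computable g) : Computable fun a => decide (f a = g a) :=
  Computable₂.comp (f := fun x y : β => decide (x = y)) (Primrec.eq.decide.to_comp) hf hg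

@[fun_prop]
theorem computable_decide_lt {f g : α → ℕ} (hf : Computable f) (hg : Computable g) :
    Computable fun a => decide (f a < g a) :=
  Computable₂.comp (f := fun x y : ℕ => decide (x < y)) (Primrec.nat_lt.decide.to_comp) hf hg

@[fun_prop]
theorem computable_decide_le {f g : α → ℕ} (hf : Computable f) (hg : Computable g) :
    Computable fun a => decide (f a ≤ g a) :=
  Computable₂.comp (f := fun x y : ℕ => decide (x ≤ y)) (Primrec.nat_le.decide.to_comp) hf hg

@[fun_prop]
theorem computable_and {f g : α → Bool} (hf : Computable f) (hg : Computable g) :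
    Computable fun a => (f a && g a) :=
  Primrec.and.to_comp.comp hf hg

@[fun_prop]
theorem computable_or {f g : α → Bool} (hf : Computable f) (hg : Computable g) :
    Computable fun a => (f a || g a) :=
  Primrec.or.to_comp.comp hf hg

@[fun_prop]
theorem computable_not {f : α → Bool} (hf : Computable f) : Computable fun a => !(f a) :=
  Primrec.not.to_comp.comp hf

@[fun_prop]
theorem computable_cond {c : α → Bool} {f g : α → β} (hc : Computable c) (hf : Computable f)
    (hg : Computable g) : Computable fun a => bif c a then f a else g a :=
  Computable.cond hc hf hg

@[fun_prop]
theorem computable_length {f : α → List β} (hf : Computable f) :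
    Computable fun a => (f a).length :=
  Computable.list_length.comp hf

@[fun_prop]
theorem computable_append {f g : α → List β} (hf : Computable f) (hg : Computable g) :
    Computable fun a => f a ++ g a :=
  Computable.list_append.comp hf hg

@[fun_prop]
theorem computable_getElem? {f : α → List β} {g : α → ℕ} (hf : Computable f)
    (hg : Computable g) : Computable fun a => (f a)[g a]? :=
  Computable.list_getElem?.comp hf hg

@[fun_prop]
theorem computable_option_getD {f : α → Option β} {g : α → β} (hf : Computable f)
    (hg : Computable g) : Computable fun a => (f a).getD (g a) :=
  Computable.option_getD hf hg

@[fun_prop]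
theorem computable_list_getD {f : α → List β} {g : α → ℕ} {h : α → β} (hf : Computable f)
    (hg : Computable g) (hh : Computable h) : Computable fun a => (f a).getD (g a) (h a) := by
  simp only [List.getD_eq_getElem?_getD]
  fun_prop

@[fun_prop]
theorem computable_some {f : α → β} (hf : Computable f) : Computable fun a => some (f a) :=
  Computable.option_some.comp hf

@[fun_prop]
theorem computable_isNone {f : α → Option β} (hf : Computable f) :
    Computable fun a => (f a).isNone := by
  have : Primrec (fun o : Option β => o.isNone) :=
    (Primrec.not.comp Primrec.option_isSome).of_eq fun o => by cases o <;> rfl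
  exact this.to_comp.comp hf

@[fun_prop]
theorem computable_encode {f : α → β} (hf : Computable f) :
    Computable fun a => Encodable.encode (f a) :=
  Computable.encode.comp hf

@[fun_prop]
theorem computable_decode {f : α → ℕ} (hf : Computable f) :
    Computable fun a => (Encodable.decode (f a) : Option β) :=
  Computable.decode.comp hf

@[fun_prop]
theorem computable_ofNat {σ : Type} [Denumerable σ] {f : α → ℕ} (hf : Computable f) :
    Computable fun a => Denumerable.ofNat σ (f a) :=
  (Computable.ofNat σ).comp hf

@[fun_prop]
theorem computable_bind {f : α → Option β} {g : α → β → Option γ} (hf : Computable f)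
    (hg : Computable fun p : α × β => g p.1 p.2) : Computable fun a => (f a).bind (g a) :=
  Computable.option_bind hf hg

@[fun_prop]
theorem computable_map {f : α → Option β} {g : α → β → γ} (hf : Computable f)
    (hg : Computable fun p : α × β => g p.1 p.2) : Computable fun a => (f a).map (g a) :=
  Computable.option_map hf hg

@[fun_prop]
theorem computable_evaln {k : α → ℕ} {c : α → Nat.Partrec.Code} {x : α → ℕ}
    (hk : Computable k) (hc : Computable c) (hx : Computable x) :
    Computable fun a => (c a).evaln (k a) (x a) :=
  Nat.Partrec.Code.primrec_evaln.to_comp.comp ((hk.pair hc).pair hx)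

@[fun_prop]
theorem computable_curry {c : α → Nat.Partrec.Code} {x : α → ℕ}
    (hc : Computable c) (hx : Computable x) :
    Computable fun a => (c a).curry (x a) :=
  Nat.Partrec.Code.primrec₂_curry.to_comp.comp hc hx

/-- Bounded universal quantification of Boolean predicates. -/
def ballLt (n : ℕ) (p : ℕ → Bool) : Bool := Nat.rec true (fun i b => b && p i) n

theorem ballLt_eq_true {n : ℕ} {p : ℕ → Bool} : ballLt n p = true ↔ ∀ i < n, p i = true := by
  induction n with
  | zero => simp [ballLt]
  | succ n ih =>
    have : ballLt (n + 1) p = (ballLt n p && p n) := rfl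
    rw [this, Bool.and_eq_true, ih]
    constructor
    · rintro ⟨h, h'⟩ i hi
      rcases Nat.lt_succ_iff_lt_or_eq.1 hi with h1 | rfl
      exacts [h i h1, h']
    · exact fun h => ⟨fun i hi => h i (by omega), h n (by omega)⟩

@[fun_prop]
theorem computable_ballLt {n : α → ℕ} {p : α → ℕ → Bool} (hn : Computable n)
    (hp : Computable fun x : α × ℕ => p x.1 x.2) : Computable fun a => ballLt (n a) (p a) := by
  refine Computable.nat_rec (h := fun a (x : ℕ × Bool) => x.2 && p a x.1) hn
    (Computable.const true) ?_
  have : Computable fun x : α × ℕ × Bool => p x.1 x.2.1 :=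
    hp.comp (g := fun x : α × ℕ × Bool => (x.1, x.2.1)) (by fun_prop)
  unfold Computable₂
  fun_prop

theorem exists_code_eval_encode {f : α → β} (hf : Computable f) :
    ∃ c : Code, ∀ a, c.eval (Encodable.encode a) = Part.some (Encodable.encode (f a)) := by
  obtain ⟨c, hc⟩ := Code.exists_code.1 hf
  exact ⟨c, fun a => by simp [hc]⟩

end FunProp

end

section

attribute [local irreducible] Computable

section Sig

variable {α β γ δ : Type} [Primcodable α] [Primcodable β] [Primcodable γ] [Primcodable δ]

/-- Predicates stating that a uniformly computable directed graph has an infinite path; these are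
the `Σ¹₁` predicates. -/
def Sig (P : α → Prop) : Prop :=
  ∃ R : α × ℕ × ℕ → Bool, Computable R ∧
    ∀ a, P a ↔ ∃ f : ℕ → ℕ, ∀ k, R (a, f k, f (k + 1)) = true

theorem Sig.of_graph (V : Type) [Primcodable V] {P : α → Prop} (R : α × V × V → Bool)
    (hR : Computable R) (h : ∀ a, P a ↔ ∃ f : ℕ → V, ∀ k, R (a, f k, f (k + 1)) = true) :
    Sig P := by
  refine ⟨fun x => ((Encodable.decode (α := V) x.2.1).bind fun u =>
    (Encodable.decode (α := V) x.2.2).map fun v => R (x.1, u, v)).getD false, by fun_prop, ?_⟩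
  intro a
  rw [h a]
  constructor
  · rintro ⟨f, hf⟩
    exact ⟨fun k => Encodable.encode (f k), fun k => by simpa using hf k⟩
  · rintro ⟨f, hf⟩
    have h1 : ∀ k, ∃ u : V, Encodable.decode (f k) = some u := by
      intro k
      have := hf k
      cases hu : (Encodable.decode (f k) : Option V) with
      | none => simp [hu] at this
      | some u => exact ⟨u, rfl⟩
    choose g hg using h1
    exact ⟨g, fun k => by simpa [hg] using hf k⟩

theorem Sig.of_iff {P Q : α → Prop} (hP : Sig P) (h : ∀ a, Q a ↔ P a) : Sig Q := by
  obtain ⟨R, hR, hP⟩ := hP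
  exact ⟨R, hR, fun a => (h a).trans (hP a)⟩

theorem Sig.of_bool {f : α → Bool} (hf : Computable f) : Sig fun a => f a = true := by
  refine ⟨fun x => f x.1, by fun_prop, fun a => ⟨fun h => ⟨fun _ => 0, fun _ => h⟩, ?_⟩⟩
  rintro ⟨g, hg⟩
  exact hg 0

theorem Sig.comp {P : β → Prop} (hP : Sig P) {f : α → β} (hf : Computable f) :
    Sig fun a => P (f a) := by
  obtain ⟨R, hR, hP⟩ := hP
  exact ⟨fun x => R (f x.1, x.2), by fun_prop, fun a => hP (f a)⟩

theorem Sig.and {P Q : α → Prop} (hP : Sig P) (hQ : Sig Q) : Sig fun a => P a ∧ Q a := by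
  obtain ⟨R, hR, hP⟩ := hP
  obtain ⟨S, hS, hQ⟩ := hQ
  refine Sig.of_graph (ℕ × ℕ) (fun x => R (x.1, x.2.1.1, x.2.2.1) && S (x.1, x.2.1.2, x.2.2.2))
    (by fun_prop) fun a => ?_
  rw [hP, hQ]
  constructor
  · rintro ⟨⟨f, hf⟩, g, hg⟩
    exact ⟨fun k => (f k, g k), fun k => by simp [hf, hg]⟩
  · rintro ⟨f, hf⟩
    simp only [Bool.and_eq_true] at hf
    exact ⟨⟨fun k => (f k).1, fun k => (hf k).1⟩, fun k => (f k).2, fun k => (hf k).2⟩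

theorem Sig.ex {P : α → β → Prop} (hP : Sig fun x : α × β => P x.1 x.2) :
    Sig fun a => ∃ b, P a b := by
  obtain ⟨R, hR, hP⟩ := hP
  refine Sig.of_graph (ℕ × β × ℕ) (fun x => decide (Encodable.encode x.2.1.2.1 =
    Encodable.encode x.2.2.2.1) && R ((x.1, x.2.1.2.1), x.2.1.2.2, x.2.2.2.2))
    (by fun_prop) fun a => ?_
  constructor
  · rintro ⟨b, hb⟩
    obtain ⟨f, hf⟩ := (hP (a, b)).1 hb
    exact ⟨fun k => (0, b, f k), fun k => by simp [hf]⟩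
  · rintro ⟨f, hf⟩
    simp only [Bool.and_eq_true, decide_eq_true_eq, Encodable.encode_inj] at hf
    refine ⟨(f 0).2.1, (hP (a, (f 0).2.1)).2 ⟨fun k => (f k).2.2, fun k => ?_⟩⟩
    have : ∀ k, (f k).2.1 = (f 0).2.1 := by
      intro k
      induction k with
      | zero => rfl
      | succ k ih => rw [← (hf k).1, ih]
    have h2 := (hf k).2
    rwa [this k] at h2

theorem Sig.or {P Q : α → Prop} (hP : Sig P) (hQ : Sig Q) : Sig fun a => P a ∨ Q a := by
  obtain ⟨R, hR, hP⟩ := hP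
  obtain ⟨S, hS, hQ⟩ := hQ
  have : Sig fun a => ∃ b : Bool, bif b then P a else Q a := by
    refine Sig.ex ⟨fun x => bif x.1.2 then R (x.1.1, x.2) else S (x.1.1, x.2), by fun_prop, ?_⟩
    rintro ⟨a, b⟩
    cases b
    exacts [hQ a, hP a]
  exact this.of_iff fun a => by simp [or_comm]

theorem Sig.all_nat {P : α → ℕ → Prop} (hP : Sig fun x : α × ℕ => P x.1 x.2) :
    Sig fun a => ∀ n, P a n := by
  obtain ⟨R, hR, hP⟩ := hP
  refine Sig.of_graph (List ℕ) (fun x => decide (x.2.2.length = x.2.1.length + 1) &&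
    ballLt x.2.1.length fun i => R ((x.1, i), x.2.1.getD i 0, x.2.2.getD i 0)) (by fun_prop)
    fun a => ?_
  simp only [Bool.and_eq_true, decide_eq_true_eq, ballLt_eq_true]
  constructor
  · intro h
    choose f hf using fun n => (hP (a, n)).1 (h n)
    refine ⟨fun k => (List.range k).map fun i => f i (k - i), fun k => ⟨by simp, ?_⟩⟩
    intro i hi
    simp only [List.length_map, List.length_range] at hi
    have h1 : k + 1 - i = (k - i) + 1 := by omega
    have h2 : i < k + 1 := by omega
    simpa [List.getD_eq_getElem?_getD, List.getElem?_range, hi, h2, h1] using hf i (k - i)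
  · rintro ⟨f, hf⟩ n
    have hlen : ∀ k, (f k).length = (f 0).length + k := by
      intro k
      induction k with
      | zero => rfl
      | succ k ih => rw [(hf k).1, ih, add_assoc]
    refine (hP (a, n)).2 ⟨fun k => (f (n + 1 + k)).getD n 0, fun k => ?_⟩
    exact (hf (n + 1 + k)).2 n (by rw [hlen]; omega)

theorem Sig.all {P : α → β → Prop} (hP : Sig fun x : α × β => P x.1 x.2) :
    Sig fun a => ∀ b, P a b := by
  let dec : ℕ → Option β := Encodable.decode
  have h1 : Sig fun x : α × ℕ => (dec x.2).isNone = true ∨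
      ∃ b, decide (Encodable.encode (dec x.2) = Encodable.encode (some b)) = true ∧ P x.1 b :=
    Sig.or (Sig.of_bool (by fun_prop)) (Sig.ex (Sig.and (Sig.of_bool (by fun_prop))
      (hP.comp (f := fun y : (α × ℕ) × β => (y.1.1, y.2)) (by fun_prop))))
  refine (Sig.all_nat (P := fun a n => (dec n).isNone = true ∨
      ∃ b, decide (Encodable.encode (dec n) = Encodable.encode (some b)) = true ∧ P a b)
      h1).of_iff fun a => ⟨fun h n => ?_, fun h b => ?_⟩
  · cases hn : dec n with
    | none => simp
    | some b => exact Or.inr ⟨b, by simp, h b⟩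
  · rcases h (Encodable.encode b) with h | ⟨b', hb, h⟩
    · simp [dec] at h
    · simp only [dec, Encodable.encodek, decide_eq_true_eq, Encodable.encode_inj,
        Option.some.injEq] at hb
      exact hb ▸ h

/-- `Δ¹₁` predicates. -/
def Del (P : α → Prop) : Prop := Sig P ∧ Sig fun a => ¬ P a

theorem Del.sig {P : α → Prop} (hP : Del P) : Sig P := hP.1

theorem Del.of_iff {P Q : α → Prop} (hP : Del P) (h : ∀ a, Q a ↔ P a) : Del Q :=
  ⟨hP.1.of_iff h, hP.2.of_iff fun a => not_congr (h a)⟩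

theorem Del.of_bool {f : α → Bool} (hf : Computable f) : Del fun a => f a = true :=
  ⟨Sig.of_bool hf, (Sig.of_bool (f := fun a => !(f a)) (by fun_prop)).of_iff fun a => by simp⟩

theorem Del.of_decide {P : α → Prop} [DecidablePred P] (hf : Computable fun a => decide (P a)) :
    Del P :=
  (Del.of_bool hf).of_iff fun a => by simp

theorem Del.comp {P : β → Prop} (hP : Del P) {f : α → β} (hf : Computable f) :
    Del fun a => P (f a) :=
  ⟨hP.1.comp hf, hP.2.comp hf⟩

theorem Del.not {P : α → Prop} (hP : Del P) : Del fun a => ¬ P a :=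
  ⟨hP.2, hP.1.of_iff fun _ => not_not⟩

theorem Del.and {P Q : α → Prop} (hP : Del P) (hQ : Del Q) : Del fun a => P a ∧ Q a :=
  ⟨hP.1.and hQ.1, (hP.2.or hQ.2).of_iff fun a => by tauto⟩

theorem Del.or {P Q : α → Prop} (hP : Del P) (hQ : Del Q) : Del fun a => P a ∨ Q a :=
  ⟨hP.1.or hQ.1, (hP.2.and hQ.2).of_iff fun a => by tauto⟩

theorem Del.imp {P Q : α → Prop} (hP : Del P) (hQ : Del Q) : Del fun a => P a → Q a :=
  (hP.not.or hQ).of_iff fun a => by tauto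

theorem Del.ex {P : α → β → Prop} (hP : Del fun x : α × β => P x.1 x.2) :
    Del fun a => ∃ b, P a b :=
  ⟨hP.1.ex, (Sig.all (P := fun a b => ¬ P a b) hP.2).of_iff fun a => by simp⟩

theorem Del.all {P : α → β → Prop} (hP : Del fun x : α × β => P x.1 x.2) :
    Del fun a => ∀ b, P a b :=
  ⟨hP.1.all, (Sig.ex (P := fun a b => ¬ P a b) hP.2).of_iff fun a => by simp⟩

theorem countable_sig : {P : α → Prop | Sig P}.Countable := by
  let F : Code → α → Prop := fun c a => ∃ f : ℕ → ℕ, ∀ k,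
    c.eval (Encodable.encode (a, f k, f (k + 1))) = Part.some (Encodable.encode true)
  refine (Set.countable_range F).mono ?_
  rintro P ⟨R, hR, hP⟩
  obtain ⟨c, hc⟩ := exists_code_eval_encode hR
  refine ⟨c, funext fun a => propext ?_⟩
  rw [hP a]
  refine exists_congr fun f => forall_congr' fun k => ?_
  rw [hc, Part.some_inj, Encodable.encode_inj]

attribute [fun_prop] Del
attribute [fun_prop] Del.and Del.or Del.not Del.imp Del.ex Del.all Del.of_decide Del.comp

end Sig

end

section

/-- The Kleene–Brouwer order on finite sequences. -/
def KB (l m : List ℕ) : Prop :=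
  ∃ i < l.length, (∀ j < i, l[j]? = m[j]?) ∧ (m[i]? = none ∨ l.getD i 0 < m.getD i 0)

theorem KB.irrefl (l : List ℕ) : ¬ KB l l := by
  rintro ⟨i, hi, -, h | h⟩
  · simp only [List.getElem?_eq_none_iff] at h; omega
  · omega

theorem KB.trans {l m r : List ℕ} (h₁ : KB l m) (h₂ : KB m r) : KB l r := by
  obtain ⟨i, hi, hil, hi'⟩ := h₁
  obtain ⟨j, hj, hjl, hj'⟩ := h₂
  rcases lt_trichotomy i j with h | rfl | h
  · refine ⟨i, hi, fun k hk => (hil k hk).trans (hjl k (hk.trans h)), ?_⟩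
    rwa [List.getD_eq_getElem?_getD (l := r), ← hjl i h, ← List.getD_eq_getElem?_getD]
  · refine ⟨i, hi, fun k hk => (hil k hk).trans (hjl k hk), ?_⟩
    rcases hj' with h | h
    · exact Or.inl h
    · rcases hi' with h' | h'
      · simp only [List.getElem?_eq_none_iff] at h'; omega
      · exact Or.inr (h'.trans h)
  · have := hil j h
    refine ⟨j, h.trans hi, fun k hk => (hil k (hk.trans h)).trans (hjl k hk), ?_⟩
    rwa [List.getD_eq_getElem?_getD (l := l), this, ← List.getD_eq_getElem?_getD]

theorem KB.total (l m : List ℕ) : l = m ∨ KB l m ∨ KB m l := by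
  by_cases h : l = m
  · exact Or.inl h
  have h' : ∃ i : ℕ, l[i]? ≠ m[i]? := by
    by_contra! h'
    exact h (List.ext_getElem? h')
  classical
  obtain ⟨i, hi, hlt⟩ : ∃ i : ℕ, l[i]? ≠ m[i]? ∧ ∀ j < i, l[j]? = m[j]? :=
    ⟨Nat.find h', Nat.find_spec h', fun j hj => not_not.1 (Nat.find_min h' hj)⟩
  right
  rcases hl : l[i]? with _ | x <;> rcases hm : m[i]? with _ | y
  · exact absurd (hl.trans hm.symm) hi
  · exact Or.inr ⟨i, (List.getElem?_eq_some_iff.1 hm).1, fun j hj => (hlt j hj).symm, Or.inl hl⟩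
  · exact Or.inl ⟨i, (List.getElem?_eq_some_iff.1 hl).1, hlt, Or.inl hm⟩
  · have hxy : x ≠ y := fun e => hi (by rw [hl, hm, e])
    rcases lt_or_gt_of_ne hxy with h | h
    · exact Or.inl ⟨i, (List.getElem?_eq_some_iff.1 hl).1, hlt,
        Or.inr (by simpa [List.getD_eq_getElem?_getD, hl, hm] using h)⟩
    · exact Or.inr ⟨i, (List.getElem?_eq_some_iff.1 hm).1, fun j hj => (hlt j hj).symm,
        Or.inr (by simpa [List.getD_eq_getElem?_getD, hl, hm] using h)⟩

theorem KB.exists_limit {l : ℕ → List ℕ} (h : ∀ i, KB (l (i + 1)) (l i)) :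
    ∃ x : ℕ → ℕ, ∀ n, ∃ N, ∀ i ≥ N, ∀ j : ℕ, j < n → (l i)[j]? = some (x j) := by
  have key : ∀ n, ∃ N, ∀ j : ℕ, j < n → ∃ s, ∀ i ≥ N, (l i)[j]? = some s := by
    intro n
    induction n with
    | zero => exact ⟨0, fun j hj => absurd hj (Nat.not_lt_zero j)⟩
    | succ n ih =>
      obtain ⟨N, hN⟩ := ih
      have step : ∀ i ≥ N, n < (l (i + 1)).length ∧
          ((l i)[n]? = none ∨ (l (i + 1)).getD n 0 ≤ (l i).getD n 0) := by
        intro i hi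
        obtain ⟨p, hp, hpl, hp'⟩ := h i
        have hnp : n ≤ p := by
          by_contra! hpn
          obtain ⟨s, hs⟩ := hN p hpn
          have h1 := hs i hi
          have h2 := hs (i + 1) (by omega)
          simp [List.getD_eq_getElem?_getD, h1, h2] at hp'
        refine ⟨by omega, ?_⟩
        rcases hnp.eq_or_lt with rfl | hlt
        · exact hp'.imp_right le_of_lt
        · have := hpl n hlt
          simp [List.getD_eq_getElem?_getD, this]
      have hsome : ∀ i ≥ N + 1, n < (l i).length := by
        intro i hi
        obtain ⟨k, rfl⟩ : ∃ k, i = k + 1 := ⟨i - 1, by omega⟩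
        exact (step k (by omega)).1
      have hmono : Antitone fun k => (l (N + 1 + k)).getD n 0 := by
        refine antitone_nat_of_succ_le fun k => ?_
        rcases (step (N + 1 + k) (by omega)).2 with h | h
        · have := hsome (N + 1 + k) (by omega)
          simp only [List.getElem?_eq_none_iff] at h; omega
        · exact h
      obtain ⟨k, hk⟩ : ∃ k, ∀ m ≥ k, (l (N + 1 + m)).getD n 0 = (l (N + 1 + k)).getD n 0 :=
        ⟨Function.argmin fun k => (l (N + 1 + k)).getD n 0, fun m hm =>
          le_antisymm (hmono hm) (Function.argmin_le (fun k => (l (N + 1 + k)).getD n 0) m)⟩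
      refine ⟨N + 1 + k, fun j hj => ?_⟩
      rcases Nat.lt_succ_iff_lt_or_eq.1 hj with hj | rfl
      · obtain ⟨s, hs⟩ := hN j hj
        exact ⟨s, fun i hi => hs i (by omega)⟩
      · refine ⟨(l (N + 1 + k)).getD j 0, fun i hi => ?_⟩
        obtain ⟨m, rfl⟩ : ∃ m, i = N + 1 + m := ⟨i - (N + 1), by omega⟩
        have hm := hsome (N + 1 + m) (by omega)
        rw [← hk m (by omega)]
        simp [List.getD_eq_getElem?_getD, hm]
  have key' : ∀ j : ℕ, ∃ s, ∃ N, ∀ i ≥ N, (l i)[j]? = some s := fun j => by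
    obtain ⟨N, hN⟩ := key (j + 1)
    obtain ⟨s, hs⟩ := hN j (by omega)
    exact ⟨s, N, hs⟩
  choose x hx using key'
  refine ⟨x, fun n => ?_⟩
  obtain ⟨N, hN⟩ := key n
  refine ⟨N, fun i hi j hj => ?_⟩
  obtain ⟨s, hs⟩ := hN j hj
  obtain ⟨M, hM⟩ := hx j
  rw [hs i hi, ← hs (max N M) (le_max_left _ _), hM _ (le_max_right _ _)]

end

section

attribute [local irreducible] Computable Del

/-- Elements coding members of the Kleene–Brouwer part of the orders constructed below. -/
def Apart (y : ℕ) : Prop := y.unpair.1 = 0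

/-- `linOrdAt v` has a descending sequence inside its initial segment `Apart`. -/
def Aill (v : ℕ) : Prop := ∃ f, IsDescSeq (linOrdAt v) f ∧ ∀ i, Apart (f i)

/-- `linOrdAt v` is ill-founded, with `Apart` as an initial segment. -/
structure Special (v : ℕ) : Prop where
  valid : (linOrdAt v).IsValid
  ill : (linOrdAt v).IllFounded
  down : ∀ x y, (linOrdAt v).lt x y → Apart y → Apart x

section Order

variable {α : Type}

/-- Boolean version of `KB`. -/
def kb (l m : List ℕ) : Bool :=
  !(ballLt l.length fun i => !((ballLt i fun j => decide (l[j]? = m[j]?)) &&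
    ((m[i]?).isNone || decide (l.getD i 0 < m.getD i 0))))

theorem kb_eq_true {l m : List ℕ} : kb l m = true ↔ KB l m := by
  rw [kb, Bool.not_eq_true', ← Bool.not_eq_true, ballLt_eq_true]
  simp only [Bool.not_eq_true', not_forall, ← Bool.not_eq_true, not_not, Bool.and_eq_true,
    ballLt_eq_true, Bool.or_eq_true, decide_eq_true_eq, Option.isNone_iff_eq_none]
  simp only [KB, exists_prop]

/-- Finite sequences that are paths in the graph `R a`. -/
def chain (R : α × ℕ × ℕ → Bool) (a : α) (l : List ℕ) : Bool :=
  ballLt l.length fun j => decide (l.length ≤ j + 1) || R (a, l.getD j 0, l.getD (j + 1) 0)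

theorem chain_eq_true {R : α × ℕ × ℕ → Bool} {a : α} {l : List ℕ} : chain R a l = true ↔
    ∀ j, j + 1 < l.length → R (a, l.getD j 0, l.getD (j + 1) 0) = true := by
  simp only [chain, ballLt_eq_true, Bool.or_eq_true, decide_eq_true_eq]
  refine forall_congr' fun j => ⟨fun h hj => (h (by omega)).resolve_left (by omega), fun h hj => ?_⟩
  rw [or_iff_not_imp_left]
  exact fun h' => h (by omega)

/-- The finite sequence coded by an element. -/
def seqOf (x : ℕ) : List ℕ := Denumerable.ofNat (List ℕ) x.unpair.2

/-- The domain of the order attached to `R a`: paths, followed by a copy of `ω*`. -/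
def orderDom (R : α × ℕ × ℕ → Bool) (a : α) (x : ℕ) : Bool :=
  (decide (x.unpair.1 = 0) && chain R a (seqOf x)) ||
    (decide (1 ≤ x.unpair.1) && decide (x.unpair.2 = 0))

/-- The order attached to `R a`. -/
def orderLt (R : α × ℕ × ℕ → Bool) (a : α) (x y : ℕ) : Bool :=
  orderDom R a x && (orderDom R a y &&
    ((decide (x.unpair.1 = 0) && decide (1 ≤ y.unpair.1)) ||
    (decide (1 ≤ y.unpair.1) && decide (y.unpair.1 < x.unpair.1)) ||
    (decide (x.unpair.1 = 0) && decide (y.unpair.1 = 0) && kb (seqOf x) (seqOf y))))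

/-- The order attached to `R a` as a presentation of a linear order. -/
def orderOf (R : α × ℕ × ℕ → Bool) (a : α) : LinOrd :=
  ⟨{x | orderDom R a x = true}, fun x y => orderLt R a x y = true⟩

theorem orderDom_iff {R : α × ℕ × ℕ → Bool} {a : α} {x : ℕ} : x ∈ (orderOf R a).dom ↔
    (x.unpair.1 = 0 ∧ chain R a (seqOf x) = true) ∨ (1 ≤ x.unpair.1 ∧ x.unpair.2 = 0) := by
  simp [orderOf, orderDom]

theorem orderLt_iff {R : α × ℕ × ℕ → Bool} {a : α} {x y : ℕ} : (orderOf R a).lt x y ↔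
    x ∈ (orderOf R a).dom ∧ y ∈ (orderOf R a).dom ∧ ((x.unpair.1 = 0 ∧ 1 ≤ y.unpair.1) ∨
      (1 ≤ y.unpair.1 ∧ y.unpair.1 < x.unpair.1) ∨
      (x.unpair.1 = 0 ∧ y.unpair.1 = 0 ∧ KB (seqOf x) (seqOf y))) := by
  simp only [orderOf, orderLt, Bool.and_eq_true, Bool.or_eq_true, decide_eq_true_eq, kb_eq_true,
    Set.mem_ofPred_eq, and_assoc, or_assoc]

theorem eq_of_seqOf_eq {x y : ℕ} (h : x.unpair.1 = y.unpair.1) (h' : seqOf x = seqOf y) :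
    x = y := by
  have : x.unpair.2 = y.unpair.2 := by
    simpa [seqOf] using congrArg Encodable.encode h'
  rw [← Nat.pair_unpair x, ← Nat.pair_unpair y, h, this]

theorem orderOf_isValid (R : α × ℕ × ℕ → Bool) (a : α) : (orderOf R a).IsValid := by
  refine ⟨fun x y h => ?_, fun x h => ?_, fun x y z h h' => ?_, fun x hx y hy => ?_⟩
  · exact ⟨(orderLt_iff.1 h).1, (orderLt_iff.1 h).2.1⟩
  · rcases (orderLt_iff.1 h).2.2 with h | h | h
    · omega
    · omega
    · exact KB.irrefl _ h.2.2
  · obtain ⟨hx, hy, h⟩ := orderLt_iff.1 h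
    obtain ⟨-, hz, h'⟩ := orderLt_iff.1 h'
    refine orderLt_iff.2 ⟨hx, hz, ?_⟩
    rcases h with h | h | ⟨h1, h2, h3⟩ <;> rcases h' with h' | h' | ⟨h1', h2', h3'⟩
    all_goals first | omega | skip
    exact Or.inr (Or.inr ⟨h1, h2', h3.trans h3'⟩)
  · simp only [orderLt_iff, hx, hy, true_and]
    rcases Nat.eq_zero_or_pos x.unpair.1 with h | h <;>
      rcases Nat.eq_zero_or_pos y.unpair.1 with h' | h'
    · rcases KB.total (seqOf x) (seqOf y) with e | e | e
      · exact Or.inl (eq_of_seqOf_eq (h.trans h'.symm) e)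
      · exact Or.inr (Or.inl (Or.inr (Or.inr ⟨h, h', e⟩)))
      · exact Or.inr (Or.inr (Or.inr (Or.inr ⟨h', h, e⟩)))
    · omega
    · omega
    · rcases lt_trichotomy x.unpair.1 y.unpair.1 with e | e | e
      · omega
      · left
        rw [orderDom_iff] at hx hy
        have h2 : x.unpair.2 = y.unpair.2 := by omega
        rw [← Nat.pair_unpair x, ← Nat.pair_unpair y, e, h2]
      · omega

theorem orderOf_illFounded (R : α × ℕ × ℕ → Bool) (a : α) : (orderOf R a).IllFounded := by
  have hd : ∀ i, Nat.pair (i + 1) 0 ∈ (orderOf R a).dom := fun i => orderDom_iff.2 (by simp)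
  exact ⟨fun i => Nat.pair (i + 1) 0, fun i => ⟨hd i, orderLt_iff.2 ⟨hd _, hd _, by simp⟩⟩⟩

theorem orderOf_down {R : α × ℕ × ℕ → Bool} {a : α} {x y : ℕ} (h : (orderOf R a).lt x y)
    (hy : Apart y) : Apart x := by
  have := (orderLt_iff.1 h).2.2
  unfold Apart at *
  omega

theorem orderOf_apart_iff {R : α × ℕ × ℕ → Bool} {a : α} :
    (∃ f, IsDescSeq (orderOf R a) f ∧ ∀ i, Apart (f i)) ↔
      ∃ f : ℕ → ℕ, ∀ k, R (a, f k, f (k + 1)) = true := by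
  constructor
  · rintro ⟨f, hf, hA⟩
    have hkb : ∀ i, KB (seqOf (f (i + 1))) (seqOf (f i)) := fun i => by
      have h := (orderLt_iff.1 (hf i).2).2.2
      have h1 := hA i
      have h2 := hA (i + 1)
      unfold Apart at h1 h2
      rcases h with h | h | h
      · omega
      · omega
      · exact h.2.2
    obtain ⟨x, hx⟩ := KB.exists_limit (l := fun i => seqOf (f i)) hkb
    refine ⟨x, fun k => ?_⟩
    obtain ⟨N, hN⟩ := hx (k + 2)
    have h0 := hN N le_rfl k (by omega)
    have h1 := hN N le_rfl (k + 1) (by omega)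
    have hd := orderDom_iff.1 (hf N).1
    have hA' := hA N
    unfold Apart at hA'
    have hc := chain_eq_true.1 (hd.resolve_right (by omega)).2 k
      (List.getElem?_eq_some_iff.1 h1).1
    simpa [List.getD_eq_getElem?_getD, h0, h1] using hc
  · rintro ⟨f, hf⟩
    let g : ℕ → ℕ := fun i => Nat.pair 0 (Encodable.encode ((List.range i).map f))
    have hg : ∀ i, seqOf (g i) = (List.range i).map f := fun i => by simp [seqOf, g]
    have hA : ∀ i, (g i).unpair.1 = 0 := fun i => by simp [g]
    have hd : ∀ i, g i ∈ (orderOf R a).dom := fun i => by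
      refine orderDom_iff.2 (Or.inl ⟨hA i, ?_⟩)
      rw [hg, chain_eq_true]
      intro j hj
      simp only [List.length_map, List.length_range] at hj
      have hj' : j < i := by omega
      simpa [List.getD_eq_getElem?_getD, List.getElem?_range, hj, hj'] using hf j
    refine ⟨g, fun i => ⟨hd i, orderLt_iff.2 ⟨hd _, hd _, Or.inr (Or.inr ⟨hA _, hA _, ?_⟩)⟩⟩, hA⟩
    rw [hg, hg]
    refine ⟨i, by simp, fun j hj => ?_, Or.inl (by simp)⟩
    simp [hj, Nat.lt_succ_of_lt hj]

variable [Primcodable α]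

@[fun_prop]
theorem computable_kb {f g : α → List ℕ} (hf : Computable f) (hg : Computable g) :
    Computable fun a => kb (f a) (g a) := by
  unfold kb
  fun_prop

@[fun_prop]
theorem computable_seqOf {f : α → ℕ} (hf : Computable f) : Computable fun a => seqOf (f a) := by
  unfold seqOf
  fun_prop

theorem exists_index {P : α → Prop} (hP : Sig P) :
    ∃ v : α → ℕ, Computable v ∧ ∀ a, Special (v a) ∧ (Aill (v a) ↔ P a) := by
  obtain ⟨R, hR, hP⟩ := hP
  have h1 : Computable fun x : α × ℕ => orderDom R x.1 x.2 := by
    have h0 : Computable fun x : α × List ℕ => chain R x.1 x.2 := by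
      unfold chain
      fun_prop
    exact computable_or (computable_and (by fun_prop)
      (h0.comp (g := fun x : α × ℕ => (x.1, seqOf x.2)) (by fun_prop))) (by fun_prop)
  have h2 : Computable fun x : α × ℕ × ℕ => orderLt R x.1 x.2.1 x.2.2 := by
    unfold orderLt
    exact computable_and (h1.comp (g := fun x : α × ℕ × ℕ => (x.1, x.2.1)) (by fun_prop))
      (computable_and (h1.comp (g := fun x : α × ℕ × ℕ => (x.1, x.2.2)) (by fun_prop))
        (by fun_prop))
  obtain ⟨c₁, hc₁⟩ := exists_code_eval_encode h1
  obtain ⟨c₂, hc₂⟩ := exists_code_eval_encode h2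
  let v : α → ℕ := fun a => Nat.pair (Encodable.encode (c₁.curry (Encodable.encode a)))
    (Encodable.encode (c₂.curry (Encodable.encode a)))
  have e1 : ∀ a x, codeFn (v a).unpair.1 x =
      Part.some (Encodable.encode (orderDom R a x)) := fun a x => by
    simpa [v, codeFn, Code.eval_curry] using hc₁ (a, x)
  have e2 : ∀ a x, codeFn (v a).unpair.2 x =
      Part.some (Encodable.encode (orderLt R a x.unpair.1 x.unpair.2)) := fun a x => by
    have := hc₂ (a, x.unpair.1, x.unpair.2)
    rw [Encodable.encode_prod_val, Encodable.encode_prod_val, Encodable.encode_nat,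
      Encodable.encode_nat, Nat.pair_unpair] at this
    simpa [v, codeFn, Code.eval_curry] using this
  have e3 : ∀ b : Bool, Part.some (Encodable.encode b) = Part.some 1 ↔ b = true := fun b => by
    rw [Part.some_inj]; cases b <;> simp
  have e4 : ∀ a, linOrdOfCodes (v a) = orderOf R a := fun a => by
    simp only [linOrdOfCodes, e1, e2, e3, Nat.unpair_pair]
    rfl
  have e5 : ∀ a, linOrdAt (v a) = orderOf R a := fun a => by
    have : DecidesLinOrd (v a) := by
      refine ⟨fun m => ?_, fun m => ?_, ?_⟩
      · rw [e1]; trivial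
      · rw [e2]; trivial
      · rw [e4]; exact orderOf_isValid R a
    rw [linOrdAt, if_pos this, e4]
  refine ⟨v, by fun_prop, fun a => ⟨⟨?_, ?_, ?_⟩, ?_⟩⟩
  · rw [e5]; exact orderOf_isValid R a
  · rw [e5]; exact orderOf_illFounded R a
  · rw [e5]; exact fun x y => orderOf_down
  · rw [Aill, e5, hP, orderOf_apart_iff]

/-- A self-referential index: the ill-foundedness of `Apart` in `linOrdAt (v z)` is governed by
a predicate that may mention a code for `v`. -/
theorem exists_index_fixedPoint {β : Type} [Primcodable β] {P : Code × β → Prop} (hP : Sig P) :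
    ∃ (c : Code) (v : β → ℕ), Computable v ∧
      (∀ z, c.eval (Encodable.encode z) = Part.some (v z)) ∧
      ∀ z, Special (v z) ∧ (Aill (v z) ↔ P (c, z)) := by
  obtain ⟨V, hV, hVP⟩ := exists_index hP
  have hf : Partrec₂ fun (c : Code) (n : ℕ) =>
      (Part.ofOption (Encodable.decode (α := β) n)).map fun z => V (c, z) := by
    refine Partrec.map (Computable.ofOption ?_) ?_
    · fun_prop
    · show Computable fun p : (Code × ℕ) × β => V (p.1.1, p.2)
      fun_prop
  obtain ⟨c, hc⟩ := Code.fixed_point₂ hf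
  refine ⟨c, fun z => V (c, z), by fun_prop, fun z => ?_, fun z => hVP (c, z)⟩
  simp [hc]

end Order

end

section

attribute [local irreducible] Computable Del

open Classical in
/-- The first `l` bits of `X`. -/
noncomputable def initSeg (X : Set ℕ) (l : ℕ) : List Bool :=
  (List.range l).map fun i => decide (i ∈ X)

theorem initSeg_mono (X : Set ℕ) {l m : ℕ} (h : l ≤ m) : initSeg X l <+: initSeg X m := by
  obtain ⟨k, rfl⟩ := Nat.exists_eq_add_of_le h
  rw [initSeg, initSeg, List.range_add, List.map_append]
  exact List.prefix_append _ _

theorem getElem?_initSeg_true {X : Set ℕ} {l u : ℕ} :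
    (initSeg X l)[u]? = some true ↔ u < l ∧ u ∈ X := by
  simp only [initSeg, List.getElem?_map, Option.map_eq_some_iff, List.getElem?_eq_some_iff]
  simp

theorem getElem?_initSeg_false {X : Set ℕ} {l u : ℕ} :
    (initSeg X l)[u]? = some false ↔ u < l ∧ u ∉ X := by
  simp only [initSeg, List.getElem?_map, Option.map_eq_some_iff, List.getElem?_eq_some_iff]
  simp

/-- Truth is preserved when the oracle information is extended. -/
def PrefixMono (W : List Bool → ℕ → ℕ → Prop) : Prop :=
  ∀ σ τ x y, σ <+: τ → W σ x y → W τ x y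

theorem PrefixMono.initSeg {W : List Bool → ℕ → ℕ → Prop} (h : PrefixMono W) {X : Set ℕ}
    {l m x y : ℕ} (hlm : l ≤ m) (hW : W (initSeg X l) x y) : W (initSeg X m) x y :=
  h _ _ _ _ (initSeg_mono X hlm) hW

theorem exists_bound_of_mono {P : ℕ → ℕ → Prop} (hP : ∀ i l m, l ≤ m → P i l → P i m) (n : ℕ)
    (h : ∀ i < n, ∃ l, P i l) : ∃ l, ∀ i < n, P i l := by
  induction n with
  | zero => exact ⟨0, fun i hi => absurd hi (Nat.not_lt_zero i)⟩
  | succ n ih =>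
    obtain ⟨l, hl⟩ := ih fun i hi => h i (by omega)
    obtain ⟨m, hm⟩ := h n (by omega)
    refine ⟨max l m, fun i hi => ?_⟩
    rcases Nat.lt_succ_iff_lt_or_eq.1 hi with hi | rfl
    · exact hP _ _ _ (le_max_left _ _) (hl i hi)
    · exact hP _ _ _ (le_max_right _ _) hm

/-- `W` describes the graph of a functional which takes the value `f` at the oracle `X`. -/
structure Describes (X : Set ℕ) (f : ℕ →. ℕ) (W : List Bool → ℕ → ℕ → Prop) : Prop where
  del : Del fun a : List Bool × ℕ × ℕ => W a.1 a.2.1 a.2.2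
  mono : PrefixMono W
  mem_iff : ∀ x y, y ∈ f x ↔ ∃ l, W (initSeg X l) x y

section Describes

variable {X : Set ℕ} {f g : ℕ →. ℕ} {V W : List Bool → ℕ → ℕ → Prop}

theorem describes_total (X : Set ℕ) {f : ℕ → ℕ} (hf : Computable f) :
    Describes X (f : ℕ →. ℕ) fun _ x y => f x = y where
  del := by fun_prop
  mono := fun _ _ _ _ _ h => h
  mem_iff x y := by simp [eq_comm]

theorem describes_oracle (X : Set ℕ) : Describes X (chi X : ℕ →. ℕ) fun σ x y =>
    (σ[x]? = some true ∧ y = 1) ∨ (σ[x]? = some false ∧ y = 0) where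
  del := by fun_prop
  mono := by
    have key : ∀ σ τ : List Bool, ∀ x : ℕ, ∀ b, σ <+: τ → σ[x]? = some b → τ[x]? = some b := by
      rintro σ - x b ⟨t, rfl⟩ h
      rw [List.getElem?_append_left (List.getElem?_eq_some_iff.1 h).1, h]
    rintro σ τ x y h (⟨h1, h2⟩ | ⟨h1, h2⟩)
    · exact Or.inl ⟨key _ _ _ _ h h1, h2⟩
    · exact Or.inr ⟨key _ _ _ _ h h1, h2⟩
  mem_iff x y := by
    simp only [getElem?_initSeg_true, getElem?_initSeg_false, PFun.coe_val, Part.mem_some_iff, chi]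
    constructor
    · rintro rfl
      refine ⟨x + 1, ?_⟩
      by_cases hx : x ∈ X <;> simp [hx]
    · rintro ⟨l, ⟨⟨-, hx⟩, rfl⟩ | ⟨⟨-, hx⟩, rfl⟩⟩ <;> simp [hx]

theorem Describes.pair (hf : Describes X f V) (hg : Describes X g W) :
    Describes X (fun n => Nat.pair <$> f n <*> g n)
      fun σ x y => V σ x y.unpair.1 ∧ W σ x y.unpair.2 where
  del := (hf.del.comp (f := fun a : List Bool × ℕ × ℕ => (a.1, a.2.1, a.2.2.unpair.1))
    (by fun_prop)).and (hg.del.comp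
      (f := fun a : List Bool × ℕ × ℕ => (a.1, a.2.1, a.2.2.unpair.2)) (by fun_prop))
  mono := fun _ _ _ _ h h' => ⟨hf.mono _ _ _ _ h h'.1, hg.mono _ _ _ _ h h'.2⟩
  mem_iff x y := by
    simp only [seq_eq_bind_map, Part.bind_eq_bind, Part.map_eq_map, Part.mem_bind_iff,
      Part.mem_map_iff]
    constructor
    · rintro ⟨_, ⟨u, hu, rfl⟩, v, hv, rfl⟩
      obtain ⟨l, hl⟩ := (hf.mem_iff _ _).1 hu
      obtain ⟨m, hm⟩ := (hg.mem_iff _ _).1 hv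
      refine ⟨max l m, ?_⟩
      simpa using ⟨hf.mono.initSeg (le_max_left _ _) hl, hg.mono.initSeg (le_max_right _ _) hm⟩
    · rintro ⟨l, h1, h2⟩
      exact ⟨_, ⟨_, (hf.mem_iff _ _).2 ⟨l, h1⟩, rfl⟩, _, (hg.mem_iff _ _).2 ⟨l, h2⟩, by simp⟩

theorem Describes.comp (hf : Describes X f V) (hg : Describes X g W) :
    Describes X (fun n => g n >>= f) fun σ x y => ∃ z, W σ x z ∧ V σ z y where
  del := Del.ex <| (hg.del.comp
    (f := fun a : (List Bool × ℕ × ℕ) × ℕ => (a.1.1, a.1.2.1, a.2)) (by fun_prop)).and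
    (hf.del.comp (f := fun a : (List Bool × ℕ × ℕ) × ℕ => (a.1.1, a.2, a.1.2.2)) (by fun_prop))
  mono := fun _ _ _ _ h ⟨z, h1, h2⟩ => ⟨z, hg.mono _ _ _ _ h h1, hf.mono _ _ _ _ h h2⟩
  mem_iff x y := by
    refine (Part.mem_bind_iff (f := g x) (g := f)).trans ?_
    constructor
    · rintro ⟨z, hz, hy⟩
      obtain ⟨l, hl⟩ := (hf.mem_iff _ _).1 hy
      obtain ⟨m, hm⟩ := (hg.mem_iff _ _).1 hz
      exact ⟨max l m, z, hg.mono.initSeg (le_max_right _ _) hm,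
        hf.mono.initSeg (le_max_left _ _) hl⟩
    · rintro ⟨l, z, h1, h2⟩
      exact ⟨z, (hg.mem_iff _ _).2 ⟨l, h1⟩, (hf.mem_iff _ _).2 ⟨l, h2⟩⟩

/-- `h` lists the values of a primitive recursion at the parameter `a`, up to `n`. -/
def PrecTrace (V W : List Bool → ℕ → ℕ → Prop) (σ : List Bool) (a n y : ℕ) (h : List ℕ) : Prop :=
  V σ a (h.getD 0 0) ∧
    (∀ i < n, W σ (Nat.pair a (Nat.pair i (h.getD i 0))) (h.getD (i + 1) 0)) ∧ h.getD n 0 = y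

theorem Describes.prec (hf : Describes X f V) (hg : Describes X g W) :
    Describes X (Nat.unpaired fun a n =>
        n.rec (f a) fun y IH => do let i ← IH; g (Nat.pair a (Nat.pair y i)))
      fun σ x y => ∃ h, PrecTrace V W σ x.unpair.1 x.unpair.2 y h where
  del := by
    refine Del.ex (Del.and ?_ (Del.and (Del.all (Del.imp (by fun_prop) ?_)) (by fun_prop)))
    · exact hf.del.comp (f := fun a : (List Bool × ℕ × ℕ) × List ℕ =>
        (a.1.1, a.1.2.1.unpair.1, a.2.getD 0 0)) (by fun_prop)
    · exact hg.del.comp (f := fun a : ((List Bool × ℕ × ℕ) × List ℕ) × ℕ =>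
        (a.1.1.1, Nat.pair a.1.1.2.1.unpair.1 (Nat.pair a.2 (a.1.2.getD a.2 0)),
          a.1.2.getD (a.2 + 1) 0)) (by fun_prop)
  mono := fun _ _ _ _ h ⟨l, h1, h2, h3⟩ => ⟨l, hf.mono _ _ _ _ h h1,
    fun i hi => hg.mono _ _ _ _ h (h2 i hi), h3⟩
  mem_iff x y := by
    rw [Nat.unpaired]
    generalize x.unpair.1 = a
    generalize x.unpair.2 = n
    induction n generalizing y with
    | zero =>
      refine (hf.mem_iff a y).trans (exists_congr fun l => ⟨fun h => ⟨[y], h, by simp, rfl⟩, ?_⟩)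
      rintro ⟨h, h1, -, rfl⟩
      exact h1
    | succ n ih =>
      simp only [Part.bind_eq_bind, Part.mem_bind_iff]
      constructor
      · rintro ⟨z, hz, hy⟩
        obtain ⟨l, h, h1, h2, h3⟩ := (ih z).1 hz
        obtain ⟨m, hm⟩ := (hg.mem_iff _ _).1 hy
        let h' : List ℕ := (List.range (n + 1)).map (fun i => h.getD i 0) ++ [y]
        have e1 : ∀ i ≤ n, h'.getD i 0 = h.getD i 0 := fun i hi => by
          have : i < n + 1 := by omega
          simp [h', List.getD_eq_getElem?_getD, List.getElem?_append_left, this]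
        have e2 : h'.getD (n + 1) 0 = y := by
          simp [h', List.getD_eq_getElem?_getD]
        refine ⟨max l m, h', ?_, fun i hi => ?_, e2⟩
        · rw [e1 0 (Nat.zero_le n)]
          exact hf.mono.initSeg (le_max_left _ _) h1
        · rcases Nat.lt_succ_iff_lt_or_eq.1 hi with hi | rfl
          · rw [e1 i (by omega), e1 (i + 1) (by omega)]
            exact hg.mono.initSeg (le_max_left _ _) (h2 i hi)
          · rw [e1 i le_rfl, e2, h3]
            exact hg.mono.initSeg (le_max_right _ _) hm
      · rintro ⟨l, h, h1, h2, rfl⟩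
        exact ⟨h.getD n 0, (ih _).2 ⟨l, h, h1, fun i hi => h2 i (by omega), rfl⟩,
          (hg.mem_iff _ _).2 ⟨l, h2 n (by omega)⟩⟩

theorem Describes.rfind (hf : Describes X f V) :
    Describes X (fun a => Nat.rfind fun n => (fun m => m = 0) <$> f (Nat.pair a n))
      fun σ x y => V σ (Nat.pair x y) 0 ∧ ∀ i < y, ∃ z, z ≠ 0 ∧ V σ (Nat.pair x i) z where
  del := by
    refine Del.and ?_ (Del.all (Del.imp (by fun_prop) (Del.ex (Del.and (by fun_prop) ?_))))
    · exact hf.del.comp (f := fun a : List Bool × ℕ × ℕ => (a.1, Nat.pair a.2.1 a.2.2, 0))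
        (by fun_prop)
    · exact hf.del.comp (f := fun a : ((List Bool × ℕ × ℕ) × ℕ) × ℕ =>
        (a.1.1.1, Nat.pair a.1.1.2.1 a.1.2, a.2)) (by fun_prop)
  mono := fun _ _ _ _ h ⟨h1, h2⟩ => ⟨hf.mono _ _ _ _ h h1, fun i hi =>
    let ⟨z, h3, h4⟩ := h2 i hi; ⟨z, h3, hf.mono _ _ _ _ h h4⟩⟩
  mem_iff x y := by
    refine Nat.mem_rfind.trans ?_
    simp only [Part.map_eq_map, Part.mem_map_iff, decide_eq_true_eq,
      decide_eq_false_iff_not]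
    constructor
    · rintro ⟨⟨_, h1, rfl⟩, h2⟩
      obtain ⟨l, hl⟩ := (hf.mem_iff _ _).1 h1
      obtain ⟨m, hm⟩ := exists_bound_of_mono
        (P := fun i l => ∃ z, z ≠ 0 ∧ V (CFT.initSeg X l) (Nat.pair x i) z)
        (fun i l m hlm ⟨z, hz, h⟩ => ⟨z, hz, hf.mono.initSeg hlm h⟩) y fun i hi => by
          obtain ⟨z, hz, h0⟩ := h2 hi
          obtain ⟨l, hl⟩ := (hf.mem_iff _ _).1 hz
          exact ⟨l, z, h0, hl⟩
      refine ⟨max l m, hf.mono.initSeg (le_max_left _ _) hl, fun i hi => ?_⟩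
      obtain ⟨z, hz, h⟩ := hm i hi
      exact ⟨z, hz, hf.mono.initSeg (le_max_right _ _) h⟩
    · rintro ⟨l, h1, h2⟩
      refine ⟨⟨0, (hf.mem_iff _ _).2 ⟨l, h1⟩, rfl⟩, fun {m} hm => ?_⟩
      obtain ⟨z, hz, h⟩ := h2 m hm
      exact ⟨z, (hf.mem_iff _ _).2 ⟨l, h⟩, hz⟩

theorem RecursiveIn.exists_describes (h : RecursiveIn (chi X) f) : ∃ W, Describes X f W := by
  induction h with
  | zero => exact ⟨_, describes_total X (f := fun _ => 0) (by fun_prop)⟩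
  | succ => exact ⟨_, describes_total X (f := Nat.succ) Computable.succ⟩
  | left => exact ⟨_, describes_total X (f := fun n => n.unpair.1) (by fun_prop)⟩
  | right => exact ⟨_, describes_total X (f := fun n => n.unpair.2) (by fun_prop)⟩
  | oracle => exact ⟨_, describes_oracle X⟩
  | pair _ _ hf hg => exact ⟨_, hf.choose_spec.pair hg.choose_spec⟩
  | comp _ _ hf hg => exact ⟨_, hf.choose_spec.comp hg.choose_spec⟩
  | prec _ _ hf hg => exact ⟨_, hf.choose_spec.prec hg.choose_spec⟩
  | rfind _ hf => exact ⟨_, hf.choose_spec.rfind⟩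

end Describes

end

section

theorem ComputableLinOrd.del_dom {L : LinOrd} (hL : ComputableLinOrd L) {α : Type}
    [Primcodable α] {f : α → ℕ} (hf : Computable f) : Del fun a => f a ∈ L.dom := by
  obtain ⟨χ, hχ, h⟩ := hL.2.1
  exact (Del.of_bool (hχ.comp hf)).of_iff fun a => h _

theorem ComputableLinOrd.del_lt {L : LinOrd} (hL : ComputableLinOrd L) {α : Type}
    [Primcodable α] {f g : α → ℕ} (hf : Computable f) (hg : Computable g) :
    Del fun a => L.lt (f a) (g a) := by
  obtain ⟨χ, hχ, h⟩ := hL.2.2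
  exact (Del.of_bool (hχ.comp hf hg)).of_iff fun a => h _ _

attribute [local irreducible] Computable Del

/-- The reflexive closure of `L.lt` on the domain. -/
def LinOrd.le (L : LinOrd) (x y : ℕ) : Prop := x ∈ L.dom ∧ y ∈ L.dom ∧ (x = y ∨ L.lt x y)

theorem ComputableLinOrd.del_le {L : LinOrd} (hL : ComputableLinOrd L) {α : Type}
    [Primcodable α] {f g : α → ℕ} (hf : Computable f) (hg : Computable g) :
    Del fun a => L.le (f a) (g a) :=
  (hL.del_dom hf).and ((hL.del_dom hg).and (Del.or (by fun_prop) (hL.del_lt hf hg)))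

/-- The ill-founded part of `L`: starting points of descending sequences. -/
def illPart (L : LinOrd) : Set ℕ := {x | ∃ f, IsDescSeq L f ∧ f 0 = x}

section IllPart

variable {L : LinOrd}

theorem LinOrd.le_refl {x : ℕ} (hx : x ∈ L.dom) : L.le x x := ⟨hx, hx, Or.inl rfl⟩

theorem LinOrd.IsValid.le_of_lt (hL : L.IsValid) {x y : ℕ} (h : L.lt x y) : L.le x y :=
  ⟨(hL.1 x y h).1, (hL.1 x y h).2, Or.inr h⟩

theorem LinOrd.IsValid.le_trans (hL : L.IsValid) {x y z : ℕ} (h : L.le x y) (h' : L.le y z) :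
    L.le x z := by
  obtain ⟨hx, -, rfl | h⟩ := h
  · exact h'
  · obtain ⟨-, hz, rfl | h'⟩ := h'
    · exact hL.le_of_lt h
    · exact hL.le_of_lt (hL.2.2.1 _ _ _ h h')

theorem LinOrd.IsValid.lt_of_lt_of_le (hL : L.IsValid) {x y z : ℕ} (h : L.lt x y)
    (h' : L.le y z) : L.lt x z := by
  obtain ⟨-, -, rfl | h'⟩ := h'
  exacts [h, hL.2.2.1 _ _ _ h h']

theorem LinOrd.IsValid.le_of_not_lt (hL : L.IsValid) {x y : ℕ} (hx : x ∈ L.dom) (hy : y ∈ L.dom)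
    (h : ¬ L.lt y x) : L.le x y := by
  rcases hL.2.2.2 x hx y hy with h' | h' | h'
  exacts [⟨hx, hy, Or.inl h'⟩, ⟨hx, hy, Or.inr h'⟩, absurd h' h]

theorem exists_descSeq_of_forall_exists (hL : L.IsValid) {A : Set ℕ}
    (hA : ∀ x ∈ A, ∃ y ∈ A, L.lt y x) {x : ℕ} (hx : x ∈ A) :
    ∃ f, IsDescSeq L f ∧ f 0 = x ∧ ∀ i, f i ∈ A := by
  choose! g hgA hg using hA
  have hmem : ∀ i, g^[i] x ∈ A := by
    intro i
    induction i with
    | zero => exact hx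
    | succ i ih => rw [Function.iterate_succ_apply']; exact hgA _ ih
  refine ⟨fun i => g^[i] x, fun i => ?_, rfl, hmem⟩
  have := hg _ (hmem i)
  simp only [Function.iterate_succ_apply']
  exact ⟨(hL.1 _ _ this).2, this⟩

theorem IsDescSeq.mem_illPart {f : ℕ → ℕ} (hf : IsDescSeq L f) (n : ℕ) : f n ∈ illPart L :=
  ⟨fun i => f (n + i), fun i => hf (n + i), rfl⟩

theorem illPart_nonempty (h : L.IllFounded) : (illPart L).Nonempty :=
  let ⟨f, hf⟩ := h
  ⟨f 0, hf.mem_illPart 0⟩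

theorem illPart_subset_dom {x : ℕ} (hx : x ∈ illPart L) : x ∈ L.dom := by
  obtain ⟨f, hf, rfl⟩ := hx
  exact (hf 0).1

theorem exists_lt_of_mem_illPart {x : ℕ} (hx : x ∈ illPart L) : ∃ y ∈ illPart L, L.lt y x := by
  obtain ⟨f, hf, rfl⟩ := hx
  exact ⟨f 1, hf.mem_illPart 1, (hf 0).2⟩

theorem mem_illPart_of_lt (hL : L.IsValid) {x y : ℕ} (hx : x ∈ illPart L) (h : L.lt x y) :
    y ∈ illPart L := by
  obtain ⟨f, hf, rfl⟩ := hx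
  refine ⟨fun i => Nat.casesOn i y f, fun i => ?_, rfl⟩
  cases i with
  | zero => exact ⟨(hL.1 _ _ h).2, h⟩
  | succ i => exact hf i

theorem mem_illPart_of_le (hL : L.IsValid) {x y : ℕ} (hx : x ∈ illPart L) (h : L.le x y) :
    y ∈ illPart L := by
  obtain ⟨-, -, rfl | h⟩ := h
  exacts [hx, mem_illPart_of_lt hL hx h]

end IllPart

end

section

attribute [local irreducible] Computable Del

theorem Del.const {α : Type} [Primcodable α] (c : Prop) : Del fun _ : α => c := by
  by_cases h : c
  · exact (Del.of_bool (f := fun _ : α => true) (by fun_prop)).of_iff fun _ => by simp [h]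
  · exact (Del.of_bool (f := fun _ : α => false) (by fun_prop)).of_iff fun _ => by simp [h]

theorem Del.forall_lt {α : Type} [Primcodable α] {P : ℕ → α → Prop} (k : ℕ)
    (h : ∀ i < k, Del (P i)) : Del fun a => ∀ i < k, P i a := by
  induction k with
  | zero => exact (Del.const True).of_iff fun _ => by simp
  | succ k ih =>
    refine ((ih fun i hi => h i (by omega)).and (h k (by omega))).of_iff fun a => ?_
    simp only [Nat.lt_succ_iff_lt_or_eq]
    exact ⟨fun h => ⟨fun i hi => h i (Or.inl hi), h k (Or.inr rfl)⟩,
      fun h i hi => hi.elim (h.1 i) fun e => e ▸ h.2⟩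

theorem exists_tuple {k : ℕ} {bad : ℕ → Prop} {Q : ℕ → ℕ → Prop}
    (h : ∀ i < k, bad i → ∃ x, Q i x) : ∃ p : List ℕ, ∀ i < k, bad i → Q i (p.getD i 0) := by
  choose! f hf using h
  refine ⟨(List.range k).map f, fun i hi hb => ?_⟩
  simpa [List.getD_eq_getElem?_getD, hi] using hf i hi hb

section Tuples

/-- Coordinatewise order of tuples, on the coordinates in `bad` below `k`. -/
def TupleLE (L : ℕ → LinOrd) (k : ℕ) (bad : ℕ → Prop) (p q : List ℕ) : Prop :=
  ∀ i < k, bad i → (L i).le (p.getD i 0) (q.getD i 0)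

/-- Tuples whose relevant coordinates lie in the ill-founded parts. -/
def IllTuple (L : ℕ → LinOrd) (k : ℕ) (bad : ℕ → Prop) (p : List ℕ) : Prop :=
  ∀ i < k, bad i → p.getD i 0 ∈ illPart (L i)

/-- `p` is a tuple below `q` at which the `n`-th of the predicates `V q` is the first to fail. -/
def Fails (L : ℕ → LinOrd) (k : ℕ) (bad : ℕ → Prop) (V : List ℕ → ℕ → List ℕ → Prop)
    (q : List ℕ) (n : ℕ) (p : List ℕ) : Prop :=
  TupleLE L k bad p q ∧ (∀ m < n, V q m p) ∧ ¬ V q n p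

/-- Iterated refinement of `Fails`, making one coordinate after the other nondecreasing. -/
def Refined (L : ℕ → LinOrd) (k : ℕ) (bad : ℕ → Prop) (V : List ℕ → ℕ → List ℕ → Prop)
    (q : List ℕ) : ℕ → ℕ → List ℕ → Prop
  | 0, n, p => Fails L k bad V q n p
  | j + 1, n, p => Refined L k bad V q j n p ∧ (bad j → ∀ m p', n < m →
      Refined L k bad V q j m p' → (L j).le (p.getD j 0) (p'.getD j 0))

/-- Eventually, the `j`-th coordinates of refined tuples have no minimum. -/
def NoMin (L : ℕ → LinOrd) (k : ℕ) (bad : ℕ → Prop) (V : List ℕ → ℕ → List ℕ → Prop)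
    (j : ℕ) (q : List ℕ) : Prop :=
  ∃ K, (∃ m p, K ≤ m ∧ Refined L k bad V q j m p) ∧ ∀ m p, K ≤ m → Refined L k bad V q j m p →
    ∃ m' p', K ≤ m' ∧ Refined L k bad V q j m' p' ∧ (L j).lt (p'.getD j 0) (p.getD j 0)

variable {L : ℕ → LinOrd} {k : ℕ} {bad : ℕ → Prop} {V : List ℕ → ℕ → List ℕ → Prop}

theorem del_tupleLE (hL : ∀ i, ComputableLinOrd (L i)) {α : Type} [Primcodable α]
    {f g : α → List ℕ} (hf : Computable f) (hg : Computable g) :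
    Del fun a => TupleLE L k bad (f a) (g a) :=
  Del.forall_lt k fun i _ => (Del.const (bad i)).imp ((hL i).del_le (by fun_prop) (by fun_prop))

theorem del_refined (hL : ∀ i, ComputableLinOrd (L i))
    (hV : Del fun a : List ℕ × ℕ × List ℕ => V a.1 a.2.1 a.2.2) (j : ℕ) :
    Del fun a : List ℕ × ℕ × List ℕ => Refined L k bad V a.1 j a.2.1 a.2.2 := by
  induction j with
  | zero =>
    refine (del_tupleLE hL (by fun_prop) (by fun_prop)).and
      (Del.and (Del.all (Del.imp (by fun_prop) ?_)) hV.not)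
    exact hV.comp (f := fun a : (List ℕ × ℕ × List ℕ) × ℕ => (a.1.1, a.2, a.1.2.2)) (by fun_prop)
  | succ j ih =>
    refine ih.and ((Del.const (bad j)).imp (Del.all (Del.all (Del.imp (by fun_prop)
      (Del.imp ?_ ((hL j).del_le (by fun_prop) (by fun_prop)))))))
    exact ih.comp (f := fun a : ((List ℕ × ℕ × List ℕ) × ℕ) × List ℕ =>
      (a.1.1.1, a.1.2, a.2)) (by fun_prop)

theorem del_noMin (hL : ∀ i, ComputableLinOrd (L i))
    (hV : Del fun a : List ℕ × ℕ × List ℕ => V a.1 a.2.1 a.2.2) (j : ℕ) :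
    Del (NoMin L k bad V j) := by
  have h := del_refined (k := k) (bad := bad) hL hV j
  refine Del.ex (Del.and (Del.ex (Del.ex (Del.and (by fun_prop) ?_))) (Del.all (Del.all (Del.imp
    (by fun_prop) (Del.imp ?_ (Del.ex (Del.ex (Del.and (by fun_prop) (Del.and ?_
    ((hL j).del_lt (by fun_prop) (by fun_prop))))))))))) 
  · exact h.comp (f := fun a : ((List ℕ × ℕ) × ℕ) × List ℕ => (a.1.1.1, a.1.2, a.2)) (by fun_prop)
  · exact h.comp (f := fun a : ((List ℕ × ℕ) × ℕ) × List ℕ => (a.1.1.1, a.1.2, a.2)) (by fun_prop)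
  · exact h.comp (f := fun a : ((((List ℕ × ℕ) × ℕ) × List ℕ) × ℕ) × List ℕ =>
      (a.1.1.1.1.1, a.1.2, a.2)) (by fun_prop)

theorem Refined.fails {q : List ℕ} {j n : ℕ} {p : List ℕ} (h : Refined L k bad V q j n p) :
    Fails L k bad V q n p := by
  induction j with
  | zero => exact h
  | succ j ih => exact ih h.1

theorem Refined.of_le {q : List ℕ} {i j n : ℕ} {p : List ℕ} (hij : i ≤ j)
    (h : Refined L k bad V q j n p) : Refined L k bad V q i n p := by
  induction j, hij using Nat.le_induction with
  | base => exact h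
  | succ j _ ih => exact ih h.1

theorem NoMin.mem_illPart (hL : ∀ i, ComputableLinOrd (L i)) {j : ℕ} (hj : j < k) (hb : bad j)
    {q : List ℕ} (h : NoMin L k bad V j q) : q.getD j 0 ∈ illPart (L j) := by
  obtain ⟨K, ⟨m, p, hm, hp⟩, hK⟩ := h
  obtain ⟨f, hf, hf0, -⟩ := exists_descSeq_of_forall_exists (hL j).1
    (A := {x | ∃ m p, K ≤ m ∧ Refined L k bad V q j m p ∧ p.getD j 0 = x})
    (by
      rintro _ ⟨m, p, hm, hp, rfl⟩
      obtain ⟨m', p', h1, h2, h3⟩ := hK m p hm hp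
      exact ⟨_, ⟨m', p', h1, h2, rfl⟩, h3⟩) ⟨m, p, hm, hp, rfl⟩
  exact mem_illPart_of_le (hL j).1 ⟨f, hf, hf0⟩ (hp.fails.1 j hj hb)

/-- If every refinement step fails to destroy unboundedness, two comparable tuples fail at
different stages. -/
theorem exists_fails_pair (hL : ∀ i, ComputableLinOrd (L i)) {q : List ℕ}
    (hS : ∀ n, ∃ p, Fails L k bad V q n p) (hq : ∀ j < k, bad j → ¬ NoMin L k bad V j q) :
    ∃ n m p p', n < m ∧ Fails L k bad V q n p ∧ Fails L k bad V q m p' ∧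
      TupleLE L k bad p p' := by
  have unb : ∀ j ≤ k, ∀ K, ∃ m p, K ≤ m ∧ Refined L k bad V q j m p := by
    intro j
    induction j with
    | zero => exact fun _ K => ⟨K, (hS K).choose, le_rfl, (hS K).choose_spec⟩
    | succ j ih =>
      intro hj K
      have ih := ih (by omega) K
      by_cases hb : bad j
      · have := hq j (by omega) hb
        simp only [NoMin] at this
        push Not at this
        obtain ⟨m, p, hm, hp, hmin⟩ := this K ih
        refine ⟨m, p, hm, hp, fun _ m' p' hm' hp' => ?_⟩
        exact (hL j).1.le_of_not_lt (hp.fails.1 j (by omega) hb).1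
          (hp'.fails.1 j (by omega) hb).1 (hmin m' p' (by omega) hp')
      · obtain ⟨m, p, hm, hp⟩ := ih
        exact ⟨m, p, hm, hp, fun h => absurd h hb⟩
  obtain ⟨n, p, -, hp⟩ := unb k le_rfl 0
  obtain ⟨m, p', hm, hp'⟩ := unb k le_rfl (n + 1)
  refine ⟨n, m, p, p', hm, hp.fails, hp'.fails, fun j hj hb => ?_⟩
  exact (Refined.of_le (j := k) (i := j + 1) hj hp).2 hb m p' hm (hp'.of_le hj.le)

theorem exists_lower_bound (hL : ∀ i, ComputableLinOrd (L i)) {p q : List ℕ}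
    (hp : IllTuple L k bad p) (hq : IllTuple L k bad q) :
    ∃ r, IllTuple L k bad r ∧ TupleLE L k bad r p ∧ TupleLE L k bad r q := by
  obtain ⟨r, hr⟩ := exists_tuple (k := k) (bad := bad) (Q := fun i x => x ∈ illPart (L i) ∧
    (L i).le x (p.getD i 0) ∧ (L i).le x (q.getD i 0)) (by
      intro i hi hb
      have h1 := illPart_subset_dom (hp i hi hb)
      have h2 := illPart_subset_dom (hq i hi hb)
      by_cases h : (L i).lt (q.getD i 0) (p.getD i 0)
      · exact ⟨_, hq i hi hb, (hL i).1.le_of_lt h, LinOrd.le_refl h2⟩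
      · exact ⟨_, hp i hi hb, LinOrd.le_refl h1, (hL i).1.le_of_not_lt h1 h2 h⟩)
  exact ⟨r, fun i hi hb => (hr i hi hb).1, fun i hi hb => (hr i hi hb).2.1,
    fun i hi hb => (hr i hi hb).2.2⟩

theorem TupleLE.trans (hL : ∀ i, ComputableLinOrd (L i)) {p q r : List ℕ}
    (h : TupleLE L k bad p q) (h' : TupleLE L k bad q r) : TupleLE L k bad p r :=
  fun i hi hb => (hL i).1.le_trans (h i hi hb) (h' i hi hb)

/-- The combinatorial core: ill-founded parts that are not `Δ¹₁` rule out a `Δ¹₁` family `V` for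
which the existence of a failing tuple reflects the existence of an ill-founded solution. -/
theorem exists_reflection_failure (hL : ∀ i, ComputableLinOrd (L i))
    (hbad : ∀ i < k, bad i → ¬ Del fun x => x ∈ illPart (L i))
    (hV : Del fun a : List ℕ × ℕ × List ℕ => V a.1 a.2.1 a.2.2)
    (hanti : ∀ q n p p', TupleLE L k bad p' p → V q n p → V q n p') :
    ∃ q n, ¬ ((∃ p, Fails L k bad V q n p) ↔ ∃ p, IllTuple L k bad p ∧ V q n p) := by
  by_contra! hiff
  obtain ⟨q, hq⟩ := exists_tuple (k := k) (bad := bad)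
    (Q := fun j x => x ∈ illPart (L j) ∧ ∀ q, q.getD j 0 = x → ¬ NoMin L k bad V j q) (by
      intro j hj hb
      by_contra! h
      refine hbad j hj hb (Del.of_iff (P := fun x => ∃ q : List ℕ, q.getD j 0 = x ∧
        NoMin L k bad V j q) (Del.ex (Del.and (by fun_prop) ?_)) fun x => ⟨h x, ?_⟩)
      · exact (del_noMin hL hV j).comp (by fun_prop)
      · rintro ⟨q, rfl, hq⟩
        exact hq.mem_illPart hL hj hb)
  have hqI : IllTuple L k bad q := fun i hi hb => (hq i hi hb).1
  have key : ∀ n, ∃ r, IllTuple L k bad r ∧ TupleLE L k bad r q ∧ ∀ m < n, V q m r := by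
    intro n
    induction n with
    | zero => exact ⟨q, hqI, fun i hi hb => LinOrd.le_refl (illPart_subset_dom (hqI i hi hb)),
        fun m hm => absurd hm (Nat.not_lt_zero m)⟩
    | succ n ih =>
      obtain ⟨r, hr, hrq, hrV⟩ := ih
      obtain ⟨p, hp, hpV⟩ : ∃ p, IllTuple L k bad p ∧ V q n p := by
        by_cases h : V q n r
        · exact ⟨r, hr, h⟩
        · exact (hiff q n).1 ⟨r, hrq, hrV, h⟩
      obtain ⟨s, hs, hsr, hsp⟩ := exists_lower_bound hL hr hp
      refine ⟨s, hs, hsr.trans hL hrq, fun m hm => ?_⟩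
      rcases Nat.lt_succ_iff_lt_or_eq.1 hm with hm | rfl
      · exact hanti _ _ _ _ hsr (hrV m hm)
      · exact hanti _ _ _ _ hsp hpV
  have hS : ∀ n, ∃ p, Fails L k bad V q n p := by
    intro n
    obtain ⟨r, hr, hrq, hrV⟩ := key (n + 1)
    exact (hiff q n).2 ⟨r, hr, hrV n (by omega)⟩
  obtain ⟨n, m, p, p', hnm, hp, hp', hle⟩ :=
    exists_fails_pair hL hS fun j hj hb => (hq j hj hb).2 q rfl
  exact hp.2.2 (hanti _ _ _ _ hle (hp'.2.1 n hnm))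

end Tuples

end

section

attribute [local irreducible] Computable Del

section Diagonal

variable {L : ℕ → LinOrd} {k : ℕ} {bad : ℕ → Prop}

/-- Diagonalization: no `Δ¹₁` condition of the form `∃ p, U v p`, with `p` ranging over
ill-founded tuples, is equivalent to ill-foundedness of `Apart` for all special indices. -/
theorem exists_special_not_iff (hL : ∀ i, ComputableLinOrd (L i))
    (hbad : ∀ i < k, bad i → ¬ Del fun x => x ∈ illPart (L i)) {U : ℕ → List ℕ → Prop}
    (hU : Del fun a : ℕ × List ℕ => U a.1 a.2)
    (hanti : ∀ v p p', TupleLE L k bad p' p → U v p → U v p') :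
    ∃ v, Special v ∧ ¬ (Aill v ↔ ∃ p, IllTuple L k bad p ∧ U v p) := by
  let T : Code → List ℕ → ℕ → List ℕ → Prop := fun c q n p =>
    ∃ s w, c.evaln s (Encodable.encode (q, n)) = some w ∧ U w p
  have hT : Del fun a : Code × List ℕ × ℕ × List ℕ => T a.1 a.2.1 a.2.2.1 a.2.2.2 :=
    Del.ex (Del.ex (Del.and (by fun_prop) (hU.comp
      (f := fun a : ((Code × List ℕ × ℕ × List ℕ) × ℕ) × ℕ => (a.2, a.1.1.2.2.2))
      (by fun_prop))))
  have hP : Del fun a : Code × List ℕ × ℕ => ∃ p, Fails L k bad (T a.1) a.2.1 a.2.2 p := by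
    refine Del.ex ((del_tupleLE hL (by fun_prop) (by fun_prop)).and
      (Del.and (Del.all (Del.imp (by fun_prop) ?_)) (Del.not ?_)))
    · exact hT.comp (f := fun a : ((Code × List ℕ × ℕ) × List ℕ) × ℕ =>
        (a.1.1.1, a.1.1.2.1, a.2, a.1.2)) (by fun_prop)
    · exact hT.comp (f := fun a : (Code × List ℕ × ℕ) × List ℕ =>
        (a.1.1, a.1.2.1, a.1.2.2, a.2)) (by fun_prop)
  obtain ⟨c, v, hv, hcv, hvP⟩ := exists_index_fixedPoint hP.sig
  have hTU : T c = fun q n p => U (v (q, n)) p := by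
    funext q n p
    refine propext ⟨?_, fun h => ?_⟩
    · rintro ⟨s, w, hw, h⟩
      have := Code.evaln_sound hw
      rw [hcv, Part.mem_some_iff] at this
      exact this ▸ h
    · have : v (q, n) ∈ c.eval (Encodable.encode (q, n)) := by rw [hcv]; exact Part.mem_some _
      obtain ⟨s, hs⟩ := Code.evaln_complete.1 this
      exact ⟨s, _, hs, h⟩
  obtain ⟨q, n, h⟩ := exists_reflection_failure hL hbad (V := fun q n p => U (v (q, n)) p)
    (hU.comp (f := fun a : List ℕ × ℕ × List ℕ => (v (a.1, a.2.1), a.2.2)) (by fun_prop))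
    fun q n => hanti _
  refine ⟨v (q, n), (hvP (q, n)).1, fun h' => h (Iff.trans ?_ h')⟩
  rw [(hvP (q, n)).2, hTU]

end Diagonal

end

section

attribute [local irreducible] Computable Del

theorem countable_computableLinOrd : {L : LinOrd | ComputableLinOrd L}.Countable := by
  let e : LinOrd → (ℕ → Prop) × (ℕ × ℕ → Prop) := fun L => (fun a => a ∈ L.dom, fun a => L.lt a.1 a.2)
  refine Set.MapsTo.countable_of_injOn (f := e)
    (t := {P : ℕ → Prop | Sig P} ×ˢ {P : ℕ × ℕ → Prop | Sig P}) ?_ ?_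
    (countable_sig.prod countable_sig)
  · intro L hL
    exact ⟨(hL.del_dom (f := fun a : ℕ => a) (by fun_prop)).sig,
      (hL.del_lt (f := fun a : ℕ × ℕ => a.1) (g := fun a => a.2) (by fun_prop) (by fun_prop)).sig⟩
  · rintro ⟨d, r⟩ - ⟨d', r'⟩ - h
    obtain ⟨h₁, h₂⟩ := Prod.mk.inj h
    have hd : d = d' := h₁
    have hr : r = r' := by
      funext a b
      exact congrFun h₂ (a, b)
    rw [hd, hr]

theorem exists_enumeration_computableLinOrd : ∃ L : ℕ → LinOrd, (∀ i, ComputableLinOrd (L i)) ∧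
    ∀ M, ComputableLinOrd M → ∃ i, L i = M := by
  have hne : {L : LinOrd | ComputableLinOrd L}.Nonempty :=
    ⟨⟨∅, fun _ _ => False⟩, by simp [LinOrd.IsValid],
      ⟨fun _ => false, Computable.const false, by simp⟩,
      ⟨fun _ _ => false, Computable.const (α := ℕ × ℕ) false, by simp⟩⟩
  obtain ⟨L, hL⟩ := countable_computableLinOrd.exists_eq_range hne
  refine ⟨L, fun i => ?_, fun M hM => ?_⟩
  · have : L i ∈ Set.range L := ⟨i, rfl⟩
    rwa [← hL] at this
  · have : M ∈ Set.range L := hL ▸ hM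
    exact this

/-- A forcing condition: a finite initial segment of the generic set, and the number of columns
in which all further elements are required to code members of the ill-founded part. -/
structure Cond (L : ℕ → LinOrd) where
  seg : List Bool
  cols : ℕ

/-- The coding requirement imposed on a number by the first `k` columns. -/
def Coded (L : ℕ → LinOrd) (k u : ℕ) : Prop :=
  u.unpair.1 < k → u.unpair.2.unpair.1 ∈ illPart (L u.unpair.1)

variable {L : ℕ → LinOrd}

theorem Coded.mono {k m u : ℕ} (h : Coded L m u) (hkm : k ≤ m) : Coded L k u :=
  fun hu => h (hu.trans_le hkm)

instance : Preorder (Cond L) where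
  le c d := c.seg <+: d.seg ∧ c.cols ≤ d.cols ∧
    ∀ u, c.seg.length ≤ u → d.seg[u]? = some true → Coded L c.cols u
  le_refl c := ⟨List.prefix_refl _, le_rfl, fun u hu h => by
    rw [List.getElem?_eq_none hu] at h; cases h⟩
  le_trans := by
    rintro a b c ⟨h₁, h₂, h₃⟩ ⟨h₄, h₅, h₆⟩
    refine ⟨h₁.trans h₄, h₂.trans h₅, fun u hu h => ?_⟩
    rcases lt_or_ge u b.seg.length with hb | hb
    · refine h₃ u hu ?_
      rw [← h, List.prefix_iff_getElem?.1 h₄ u hb, List.getElem?_eq_getElem hb]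
    · exact (h₆ u hb h).mono h₂

/-- `X` could be the generic set of a filter containing `c`. -/
structure Compat (c : Cond L) (X : Set ℕ) : Prop where
  seg : ∀ u < c.seg.length, c.seg[u]? = some true ↔ u ∈ X
  coded : ∀ u ∈ X, c.seg.length ≤ u → Coded L c.cols u

theorem Compat.initSeg {c : Cond L} {X : Set ℕ} (h : Compat c X) {l : ℕ} (hl : c.seg.length ≤ l) :
    c.seg <+: CFT.initSeg X l := by
  rw [List.prefix_iff_getElem?]
  intro u hu
  have := h.seg u hu
  rw [List.getElem?_eq_getElem hu, Option.some_inj] at this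
  cases hb : c.seg[u] with
  | true => exact getElem?_initSeg_true.2 ⟨hu.trans_le hl, this.1 hb⟩
  | false => exact getElem?_initSeg_false.2 ⟨hu.trans_le hl, fun h' => by simp [hb] at this; exact this h'⟩

/-- Every countable family of dense sets of conditions has a generic set. -/
theorem exists_generic {ι : Type*} [Encodable ι] (D : ι → Set (Cond L))
    (hD : ∀ i c, ∃ d ∈ D i, c ≤ d) : ∃ X, ∀ i, ∃ c ∈ D i, Compat c X := by
  let 𝒟 : ι → Order.Cofinal (Cond L) := fun i => ⟨D i, hD i⟩
  let s := Order.sequenceOfCofinals (⟨[], 0⟩ : Cond L) 𝒟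
  have hs : Monotone s := Order.sequenceOfCofinals.monotone _ _
  refine ⟨{u | ∃ n, (s n).seg[u]? = some true}, fun i =>
    ⟨s (Encodable.encode i + 1), Order.sequenceOfCofinals.encode_mem _ 𝒟 i, ?_, ?_⟩⟩
  · intro u hu
    refine ⟨fun h => ⟨_, h⟩, ?_⟩
    rintro ⟨n, hn⟩
    have h₁ := (hs (le_max_left n (Encodable.encode i + 1))).1
    have h₂ := (hs (le_max_right n (Encodable.encode i + 1))).1
    have h₃ := List.prefix_iff_getElem?.1 h₂ u hu
    rw [List.getElem?_eq_getElem hu, ← h₃]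
    obtain ⟨hlt, hn'⟩ := List.getElem?_eq_some_iff.1 hn
    rw [List.prefix_iff_getElem?.1 h₁ u hlt, hn']
  · rintro u ⟨n, hn⟩ hu
    have h₁ := (hs (le_max_left n (Encodable.encode i + 1))).1
    obtain ⟨hlt, hn'⟩ := List.getElem?_eq_some_iff.1 hn
    refine (hs (le_max_right n (Encodable.encode i + 1))).2.2 u hu ?_
    rw [List.prefix_iff_getElem?.1 h₁ u hlt, hn']

theorem exists_le_cols (n : ℕ) (c : Cond L) : ∃ d : Cond L, n ≤ d.cols ∧ c ≤ d :=
  ⟨⟨c.seg, max n c.cols⟩, le_max_left _ _, List.prefix_refl _, le_max_right _ _,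
    fun u hu h => by rw [List.getElem?_eq_none hu] at h; cases h⟩

theorem exists_le_mem {i x : ℕ} (hx : x ∈ illPart (L i)) (b : ℕ) (c : Cond L) :
    ∃ d : Cond L, (∃ t, b ≤ Nat.pair i (Nat.pair x t) ∧
      d.seg[Nat.pair i (Nat.pair x t)]? = some true) ∧ c ≤ d := by
  have ht : max b c.seg.length ≤ Nat.pair i (Nat.pair x (max b c.seg.length)) :=
    (Nat.right_le_pair _ _).trans (Nat.right_le_pair _ _)
  set t := max b c.seg.length with htdef
  set u := Nat.pair i (Nat.pair x t) with hu
  have hlen : (c.seg ++ List.replicate (u - c.seg.length) false).length = u := by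
    simp only [List.length_append, List.length_replicate]; omega
  refine ⟨⟨c.seg ++ List.replicate (u - c.seg.length) false ++ [true], c.cols⟩,
    ⟨t, by omega, ?_⟩, ?_, le_rfl, ?_⟩
  · rw [← hu, List.getElem?_append_right hlen.le, hlen]; simp
  · rw [List.append_assoc]; exact List.prefix_append _ _
  · intro v hv h
    have : v = u := by
      rcases lt_trichotomy v u with hvu | hvu | hvu
      · rw [List.getElem?_append_left (by omega), List.getElem?_append_right hv] at h
        rw [List.getElem?_replicate] at h
        split_ifs at h
        cases h
      · exact hvu
      · rw [List.getElem?_eq_none] at h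
        · cases h
        · rw [List.length_append, hlen]; simp; omega
    subst this
    intro _
    simpa [hu] using hx

/-- `W` computes tight descending sequences uniformly, using the oracle `X`. -/
def UniformlyTight (W : List Bool → ℕ → ℕ → Prop) (X : Set ℕ) : Prop :=
  ∀ v, (linOrdAt v).IllFounded → ∃ g, IsTightDescSeq (linOrdAt v) g ∧
    ∀ m y, y = g m ↔ ∃ l, W (initSeg X l) (Nat.pair v m) y

end

section

attribute [local irreducible] Computable Del

variable {L : ℕ → LinOrd}

theorem exists_common_lower_bound {M : LinOrd} (hM : M.IsValid) (hne : (illPart M).Nonempty)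
    (f : ℕ → ℕ) (n : ℕ) : ∃ x ∈ illPart M, ∀ u < n, f u ∈ illPart M → M.le x (f u) := by
  induction n with
  | zero => exact hne.imp fun x hx => ⟨hx, fun u hu => absurd hu (Nat.not_lt_zero u)⟩
  | succ n ih =>
    obtain ⟨x, hx, h⟩ := ih
    by_cases hlt : M.lt (f n) x ∧ f n ∈ illPart M
    · refine ⟨f n, hlt.2, fun u hu hf => ?_⟩
      rcases Nat.lt_succ_iff_lt_or_eq.1 hu with hu | rfl
      · exact hM.le_trans (hM.le_of_lt hlt.1) (h u hu hf)
      · exact LinOrd.le_refl (illPart_subset_dom hf)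
    · refine ⟨x, hx, fun u hu hf => ?_⟩
      rcases Nat.lt_succ_iff_lt_or_eq.1 hu with hu | rfl
      · exact h u hu hf
      · exact hM.le_of_not_lt (illPart_subset_dom hx) (illPart_subset_dom hf)
          fun h' => hlt ⟨h', hf⟩

/-- The number `u` is allowed by the `i`-th column, where for `bad` columns the ill-founded part
is approximated by the final segment above the `i`-th entry of `p`. -/
def Allowed (L : ℕ → LinOrd) (bad : ℕ → Prop) (i : ℕ) (p : List ℕ) (u : ℕ) : Prop :=
  u.unpair.1 = i → (bad i → (L i).le (p.getD i 0) u.unpair.2.unpair.1) ∧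
    (¬ bad i → u.unpair.2.unpair.1 ∈ illPart (L i))

theorem del_allowed (hL : ∀ i, ComputableLinOrd (L i)) {bad : ℕ → Prop} {i : ℕ}
    (hbad : ¬ bad i → Del fun x => x ∈ illPart (L i)) {α : Type} [Primcodable α] {f : α → List ℕ}
    {g : α → ℕ} (hf : Computable f) (hg : Computable g) :
    Del fun a => Allowed L bad i (f a) (g a) := by
  refine Del.imp (by fun_prop) ?_
  by_cases hb : bad i
  · exact ((hL i).del_le (f := fun a => (f a).getD i 0) (g := fun a => (g a).unpair.2.unpair.1)
      (by fun_prop) (by fun_prop)).of_iff fun a => by simp [hb]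
  · exact ((hbad hb).comp (f := fun a => (g a).unpair.2.unpair.1) (by fun_prop)).of_iff
      fun a => by simp [hb]

/-- Some extension of `σ` which is allowed by the first `k` columns forces `W` to produce an
element of `Apart` for the index `v`. -/
def Produces (L : ℕ → LinOrd) (k : ℕ) (bad : ℕ → Prop) (W : List Bool → ℕ → ℕ → Prop)
    (σ : List Bool) (v : ℕ) (p : List ℕ) : Prop :=
  ∃ τ : List Bool, (∃ ρ, σ ++ ρ = τ) ∧
    (∀ i < k, ∀ u : ℕ, σ.length ≤ u → τ[u]? = some true → Allowed L bad i p u) ∧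
    ∃ m y, W τ (Nat.pair v m) y ∧ y.unpair.1 = 0

theorem del_produces (hL : ∀ i, ComputableLinOrd (L i)) {bad : ℕ → Prop} {k : ℕ}
    (hbad : ∀ i, ¬ bad i → Del fun x => x ∈ illPart (L i)) {W : List Bool → ℕ → ℕ → Prop}
    (hW : Del fun a : List Bool × ℕ × ℕ => W a.1 a.2.1 a.2.2) (σ : List Bool) :
    Del fun a : ℕ × List ℕ => Produces L k bad W σ a.1 a.2 := by
  refine Del.ex (Del.and (by fun_prop) (Del.and ?_ (Del.ex (Del.ex (Del.and ?_ (by fun_prop))))))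
  · refine Del.forall_lt k fun i _ => Del.all (Del.imp (by fun_prop) (Del.imp (by fun_prop) ?_))
    exact del_allowed hL (hbad i) (by fun_prop) (by fun_prop)
  · exact hW.comp (f := fun a : (((ℕ × List ℕ) × List Bool) × ℕ) × ℕ =>
      (a.1.1.2, Nat.pair a.1.1.1.1 a.1.2, a.2)) (by fun_prop)

theorem IsTightDescSeq.exists_apart {v : ℕ} (hv : Special v) (h : Aill v) {g : ℕ → ℕ}
    (hg : IsTightDescSeq (linOrdAt v) g) : ∃ m, Apart (g m) := by
  obtain ⟨f, hf, hA⟩ := h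
  obtain ⟨m, hm⟩ := hg.2 f hf 0
  exact ⟨m, hv.down _ _ hm (hA 0)⟩

theorem IsDescSeq.aill {v : ℕ} (hv : Special v) {g : ℕ → ℕ} (hg : IsDescSeq (linOrdAt v) g) {m : ℕ}
    (hm : Apart (g m)) : Aill v := by
  refine ⟨fun i => g (m + i), fun i => hg (m + i), fun i => ?_⟩
  induction i with
  | zero => exact hm
  | succ i ih => exact hv.down _ _ (hg (m + i)).2 ih

theorem exists_le_not_uniformlyTight (hL : ∀ i, ComputableLinOrd (L i))
    {W : List Bool → ℕ → ℕ → Prop} (hW : Del fun a : List Bool × ℕ × ℕ => W a.1 a.2.1 a.2.2)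
    (hmono : PrefixMono W) (c : Cond L) :
    ∃ d, (∀ X, Compat d X → ¬ UniformlyTight W X) ∧ c ≤ d := by
  let bad : ℕ → Prop := fun i => ¬ Del fun x => x ∈ illPart (L i)
  have hgood : ∀ i, ¬ bad i → Del fun x => x ∈ illPart (L i) := fun i h => not_not.1 h
  have hne : ∀ i, bad i → (illPart (L i)).Nonempty := fun i hb => by
    by_contra h
    rw [Set.not_nonempty_iff_eq_empty] at h
    exact hb ((Del.const False).of_iff fun x => by simp [h])
  obtain ⟨v, hv, hne'⟩ := exists_special_not_iff (k := c.cols) (bad := bad) hL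
    (fun _ _ h => h) (del_produces (k := c.cols) hL hgood hW c.seg) (by
      rintro v p p' hp ⟨τ, hτ, h, h'⟩
      refine ⟨τ, hτ, fun i hi u hu hut hui => ?_, h'⟩
      have := h i hi u hu hut hui
      exact ⟨fun hb => (hL i).1.le_trans (hp i hi hb) (this.1 hb), this.2⟩)
  by_cases hA : Aill v
  · refine ⟨c, fun X hX hU => hne' (iff_of_true hA ?_), le_rfl⟩
    obtain ⟨g, hg, hgW⟩ := hU v hv.ill
    obtain ⟨m, hm⟩ := hg.exists_apart hv hA
    obtain ⟨l, hl⟩ := (hgW m (g m)).1 rfl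
    have hl' := hmono.initSeg (le_max_left l c.seg.length) hl
    set l' := max l c.seg.length
    obtain ⟨p, hp⟩ := exists_tuple (k := c.cols) (bad := bad) fun i _ hb =>
      exists_common_lower_bound (hL i).1 (hne i hb) (fun u => u.unpair.2.unpair.1) l'
    refine ⟨p, fun i hi hb => (hp i hi hb).1, initSeg X l', hX.initSeg (le_max_right _ _),
      fun i hi u hu hut hui => ?_, m, g m, hl', hm⟩
    obtain ⟨hul, huX⟩ := getElem?_initSeg_true.1 hut
    have hmem := hX.coded u huX hu (hui ▸ hi)
    rw [hui] at hmem
    exact ⟨fun hb => (hp i hi hb).2 u hul hmem, fun _ => hmem⟩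
  · have : ∃ p, IllTuple L c.cols bad p ∧ Produces L c.cols bad W c.seg v p := by
      by_contra h
      exact hne' (iff_of_false hA h)
    obtain ⟨p, hp, τ, hτ, hall, m, y, hWy, hy⟩ := this
    refine ⟨⟨τ, c.cols⟩, fun X hX hU => hA ?_, hτ, le_rfl, fun u hu hut hi => ?_⟩
    · obtain ⟨g, hg, hgW⟩ := hU v hv.ill
      have := (hgW m y).2 ⟨τ.length, hmono _ _ _ _ (hX.initSeg le_rfl) hWy⟩
      exact hg.1.aill hv (m := m) (this ▸ hy)
    · have := hall _ hi u hu hut rfl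
      by_cases hb : bad u.unpair.1
      · exact mem_illPart_of_le (hL _).1 (hp _ hi hb) (this.1 hb)
      · exact this.2 hb

theorem exists_generic_set (hL : ∀ i, ComputableLinOrd (L i)) :
    ∃ X, (∀ n, ∃ c : Cond L, n ≤ c.cols ∧ Compat c X) ∧
      (∀ i, ∀ x ∈ illPart (L i), ∀ b, ∃ t, b ≤ Nat.pair i (Nat.pair x t) ∧
        Nat.pair i (Nat.pair x t) ∈ X) ∧
      ∀ W : List Bool → ℕ → ℕ → Prop, (Del fun a : List Bool × ℕ × ℕ => W a.1 a.2.1 a.2.2) →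
        PrefixMono W → ¬ UniformlyTight W X := by
  let S := {P : List Bool × ℕ × ℕ → Prop | Sig P}
  have : Countable S := countable_sig.to_subtype
  have : Encodable S := Encodable.ofCountable S
  let D : ℕ ⊕ (ℕ × ℕ × ℕ) ⊕ S → Set (Cond L) := fun a => match a with
    | .inl n => {c | n ≤ c.cols}
    | .inr (.inl (i, x, b)) => {c | x ∈ illPart (L i) → ∃ t, b ≤ Nat.pair i (Nat.pair x t) ∧
        c.seg[Nat.pair i (Nat.pair x t)]? = some true}
    | .inr (.inr P) => {c | Del P.1 → PrefixMono (fun σ x y => P.1 (σ, x, y)) →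
        ∀ X, Compat c X → ¬ UniformlyTight (fun σ x y => P.1 (σ, x, y)) X}
  obtain ⟨X, hX⟩ := exists_generic D fun a c => by
    match a with
    | .inl n => exact exists_le_cols n c
    | .inr (.inl (i, x, b)) =>
      by_cases hx : x ∈ illPart (L i)
      · obtain ⟨d, hd, hcd⟩ := exists_le_mem hx b c
        exact ⟨d, fun _ => hd, hcd⟩
      · exact ⟨c, fun h => absurd h hx, le_rfl⟩
    | .inr (.inr P) =>
      by_cases h : Del P.1 ∧ PrefixMono (fun σ x y => P.1 (σ, x, y))
      · obtain ⟨d, hd, hcd⟩ := exists_le_not_uniformlyTight hL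
          (W := fun σ x y => P.1 (σ, x, y)) h.1 h.2 c
        exact ⟨d, fun _ _ => hd, hcd⟩
      · exact ⟨c, fun h₁ h₂ => absurd ⟨h₁, h₂⟩ h, le_rfl⟩
  refine ⟨X, fun n => hX (.inl n), fun i x hx b => ?_, fun W hW hmono => ?_⟩
  · obtain ⟨c, hc, hcX⟩ := hX (.inr (.inl (i, x, b)))
    obtain ⟨t, ht, h⟩ := hc hx
    exact ⟨t, ht, (hcX.seg _ (List.getElem?_eq_some_iff.1 h).1).1 h⟩
  · obtain ⟨c, hc, hcX⟩ := hX (.inr (.inr ⟨fun a => W a.1 a.2.1 a.2.2, hW.sig⟩))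
    exact hc hW hmono X hcX

end

section

section Search

theorem RecursiveIn.of_partrec {O : ℕ → ℕ} {f : ℕ →. ℕ} (hf : Nat.Partrec f) :
    RecursiveIn O f := by
  induction hf with
  | zero => exact .zero
  | succ => exact .succ
  | left => exact .left
  | right => exact .right
  | pair _ _ h₁ h₂ => exact .pair h₁ h₂
  | comp _ _ h₁ h₂ => exact .comp h₁ h₂
  | prec _ _ h₁ h₂ => exact .prec h₁ h₂
  | rfind _ h => exact .rfind h

theorem RecursiveIn.of_computable {O f : ℕ → ℕ} (hf : Computable f) : RecursiveIn O ↑f :=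
  .of_partrec (Partrec.nat_iff.1 hf.partrec)

theorem RecursiveIn.of_eq {O : ℕ → ℕ} {f g : ℕ →. ℕ} (hf : RecursiveIn O f)
    (h : ∀ n, f n = g n) : RecursiveIn O g := (funext h : f = g) ▸ hf

theorem RecursiveIn.comp_total {O g : ℕ → ℕ} {f : ℕ →. ℕ} (hf : RecursiveIn O f)
    (hg : RecursiveIn O ↑g) : RecursiveIn O fun n => f (g n) :=
  (hf.comp hg).of_eq fun n => Part.bind_some (g n) f

theorem RecursiveIn.pair_total {O f g : ℕ → ℕ} (hf : RecursiveIn O ↑f) (hg : RecursiveIn O ↑g) :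
    RecursiveIn O ↑fun n => Nat.pair (f n) (g n) :=
  (hf.pair hg).of_eq fun n => by simp [Seq.seq]

theorem computableIn_iff {O f : ℕ → ℕ} : ComputableIn O f ↔ RecursiveIn O ↑f := by
  unfold ComputableIn PartrecIn
  refine iff_of_eq (congrArg _ (funext fun n => ?_))
  simp

/-- The least element `w` of `X` with `R z w` can be searched for with oracle `X`. -/
theorem RecursiveIn.search (X : Set ℕ) {R : ℕ → ℕ → Bool}
    (hR : Computable fun a : ℕ × ℕ => R a.1 a.2) :
    ∃ s : ℕ →. ℕ, RecursiveIn (chi X) s ∧ ∀ z w, w ∈ X → R z w = true →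
      (∀ w' < w, ¬ (w' ∈ X ∧ R z w' = true)) → s z = Part.some w := by
  let G : ℕ → ℕ := fun a => bif R a.unpair.1.unpair.1 a.unpair.1.unpair.2 && decide (a.unpair.2 = 1)
    then 0 else 1
  have hG : Computable G := by
    have : Computable fun a : ℕ => R a.unpair.1.unpair.1 a.unpair.1.unpair.2 :=
      hR.comp (f := fun a : ℕ × ℕ => R a.1 a.2)
        (g := fun a : ℕ => (a.unpair.1.unpair.1, a.unpair.1.unpair.2)) (by fun_prop)
    fun_prop
  have hT : RecursiveIn (chi X) fun a => Part.some (G (Nat.pair a (chi X a.unpair.2))) :=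
    (RecursiveIn.of_computable hG).comp_total ((RecursiveIn.of_computable Computable.id).pair_total
      (RecursiveIn.oracle.comp_total .right))
  refine ⟨_, hT.rfind, fun z w hw hRw hmin => Part.eq_some_iff.2 (Nat.mem_rfind.2 ?_)⟩
  have key : ∀ w', G (Nat.pair (Nat.pair z w') (chi X w')) = 0 ↔ w' ∈ X ∧ R z w' = true := by
    intro w'
    by_cases h : w' ∈ X <;> by_cases h' : R z w' = true <;> simp [G, chi, h, h']
  constructor
  · simpa using (key w).2 ⟨hw, hRw⟩
  · intro w' hw'
    have := (key w').not.2 (hmin w' hw')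
    simpa using this

theorem computableIn_of_search {X : Set ℕ} {R : ℕ → ℕ → Bool}
    (hR : Computable fun a : ℕ × ℕ => R a.1 a.2) {v : ℕ → ℕ} (hv : Computable v) {f : ℕ → ℕ}
    (hf : ∀ n, ∃ w ∈ X, R (f n) w = true ∧ (∀ w' < w, ¬ (w' ∈ X ∧ R (f n) w' = true)) ∧
      f (n + 1) = v w) : ComputableIn (chi X) f := by
  obtain ⟨s, hs, h⟩ := RecursiveIn.search X hR
  rw [computableIn_iff]
  have hstep : RecursiveIn (chi X) fun a => (s a.unpair.2.unpair.2).bind fun w => Part.some (v w) :=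
    (RecursiveIn.of_computable hv).comp (hs.comp_total (RecursiveIn.right.comp_total .right))
  have hprec := RecursiveIn.prec (RecursiveIn.of_computable (Computable.const (f 0))) hstep
  refine (hprec.comp (.of_computable (f := fun n => Nat.pair 0 n) (by fun_prop))).of_eq fun n => ?_
  simp only [PFun.coe_val, Part.bind_eq_bind, Part.bind_some, Nat.unpaired, Nat.unpair_pair]
  induction n with
  | zero => rfl
  | succ n ih =>
    obtain ⟨w, hw, hRw, hmin, hfw⟩ := hf n
    simp only [ih, Part.bind_some, h _ w hw hRw hmin, hfw]

end Search

theorem PartrecIn.exists_describes {X : Set ℕ} {F : ℕ × ℕ →. ℕ} (hF : PartrecIn (chi X) F) :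
    ∃ W, Describes X (fun n => F n.unpair) W := by
  refine (RecursiveIn.of_eq hF fun n => ?_).exists_describes
  have : Encodable.decode (α := ℕ × ℕ) n = some n.unpair := by simp
  rw [this]
  simp [Part.map_id']

attribute [local irreducible] Computable Del

variable {L : ℕ → LinOrd}

theorem IsDescSeq.injective {M : LinOrd} (hM : M.IsValid) {f : ℕ → ℕ} (hf : IsDescSeq M f) :
    Function.Injective f := by
  have key : ∀ m k, M.lt (f (m + k + 1)) (f m) := by
    intro m k
    induction k with
    | zero => exact (hf m).2
    | succ k ih => exact hM.2.2.1 _ _ _ (hf _).2 ih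
  intro a b hab
  by_contra hne
  rcases Nat.lt_or_gt_of_ne hne with h | h
  · obtain ⟨k, rfl⟩ := Nat.exists_eq_add_of_lt h
    exact hM.2.1 (f a) (by simpa [← hab] using key a k)
  · obtain ⟨k, rfl⟩ := Nat.exists_eq_add_of_lt h
    exact hM.2.1 (f b) (by simpa [hab] using key b k)

theorem highForTightDS_of_coded {X : Set ℕ}
    (hsurj : ∀ M, ComputableLinOrd M → ∃ i, L i = M)
    (hX : ∀ n, ∃ c : Cond L, n ≤ c.cols ∧ Compat c X)
    (hcode : ∀ i, ∀ x ∈ illPart (L i), ∀ b, ∃ t, b ≤ Nat.pair i (Nat.pair x t) ∧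
      Nat.pair i (Nat.pair x t) ∈ X) : HighForTightDS X := by
  intro M hM hill
  obtain ⟨i, rfl⟩ := hsurj M hM
  obtain ⟨c, hc, hcX⟩ := hX (i + 1)
  obtain ⟨χ, hχ, hχlt⟩ := hM.2.2
  let R : ℕ → ℕ → Bool := fun z w => decide (c.seg.length ≤ w) && (decide (w.unpair.1 = i) &&
    χ w.unpair.2.unpair.1 z)
  have hR : Computable fun a : ℕ × ℕ => R a.1 a.2 := by
    have key : ∀ h : ℕ × ℕ → Bool, Computable h → Computable fun a : ℕ × ℕ =>
        decide (c.seg.length ≤ a.2) && (decide (a.2.unpair.1 = i) && h a) := fun h _ => by fun_prop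
    exact key _ (Computable.comp (g := fun a : ℕ × ℕ => (a.2.unpair.2.unpair.1, a.1)) hχ
      (by fun_prop))
  have hR_iff : ∀ z w, R z w = true ↔ c.seg.length ≤ w ∧ w.unpair.1 = i ∧
      (L i).lt w.unpair.2.unpair.1 z := fun z w => by simp [R, hχlt]
  have hex : ∀ z ∈ illPart (L i), ∃ w, w ∈ X ∧ R z w = true ∧
      ∀ w' < w, ¬ (w' ∈ X ∧ R z w' = true) := by
    intro z hz
    obtain ⟨y, hy, hyz⟩ := exists_lt_of_mem_illPart hz
    obtain ⟨t, ht, htX⟩ := hcode i y hy c.seg.length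
    have h : ∃ w, w ∈ X ∧ R z w = true := ⟨_, htX, (hR_iff _ _).2 ⟨ht, by simpa using hyz⟩⟩
    classical
    exact ⟨Nat.find h, (Nat.find_spec h).1, (Nat.find_spec h).2, fun w' hw' => Nat.find_min h hw'⟩
  choose! w hwX hwR hwmin using hex
  obtain ⟨x₀, hx₀⟩ := illPart_nonempty hill
  let f : ℕ → ℕ := fun n => Nat.rec x₀ (fun _ z => (w z).unpair.2.unpair.1) n
  have hf : ∀ n, f n ∈ illPart (L i) := by
    intro n
    induction n with
    | zero => exact hx₀
    | succ n ih =>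
      obtain ⟨h₁, h₂, -⟩ := (hR_iff _ _).1 (hwR _ ih)
      have := hcX.coded _ (hwX _ ih) h₁ (by omega)
      rwa [h₂] at this
  have hdesc : IsDescSeq (L i) f := fun n =>
    ⟨illPart_subset_dom (hf n), ((hR_iff _ _).1 (hwR _ (hf n))).2.2⟩
  refine ⟨f, computableIn_of_search hR (v := fun w => w.unpair.2.unpair.1) (by fun_prop)
    fun n => ⟨w (f n), hwX _ (hf n), hwR _ (hf n), hwmin _ (hf n), rfl⟩, hdesc, fun g hg n => ?_⟩
  by_contra! hcon
  obtain ⟨y, hy, hyn⟩ := exists_lt_of_mem_illPart (hg.mem_illPart n)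
  obtain ⟨t, ht, htX⟩ := hcode i y hy c.seg.length
  have hle : ∀ m, w (f m) ≤ Nat.pair i (Nat.pair y t) := fun m => by
    by_contra! hlt
    refine hwmin _ (hf m) _ hlt ⟨htX, (hR_iff _ _).2 ⟨ht, by simp, ?_⟩⟩
    have := hM.1.le_of_not_lt (hg n).1 (hdesc m).1 (hcon m)
    simpa using hM.1.lt_of_lt_of_le hyn this
  have hinj : Function.Injective fun m => w (f m) := fun a b hab => by
    have : f (a + 1) = f (b + 1) := congrArg (fun w : ℕ => w.unpair.2.unpair.1) hab
    exact Nat.succ_injective (hdesc.injective hM.1 this)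
  exact Set.infinite_of_injective_forall_mem hinj (s := Set.Iic (Nat.pair i (Nat.pair y t))) hle
    (Set.finite_Iic _)

theorem not_unifHighForTightDS {X : Set ℕ} (h : ∀ W : List Bool → ℕ → ℕ → Prop,
    (Del fun a : List Bool × ℕ × ℕ => W a.1 a.2.1 a.2.2) → PrefixMono W → ¬ UniformlyTight W X) :
    ¬ UnifHighForTightDS X := by
  rintro ⟨F, hF, hU⟩
  obtain ⟨W, hW⟩ := hF.exists_describes
  refine h W hW.del hW.mono fun v hv => ?_
  obtain ⟨g, hg, hFg⟩ := hU v hv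
  refine ⟨g, hg, fun m y => ?_⟩
  rw [← hW.mem_iff, Nat.unpair_pair, hFg, Part.mem_some_iff]

end

/-- There is a set that is high for tight descending sequences but not
uniformly high for tight descending sequences. -/
theorem exists_highForTightDS_not_unifHighForTightDS :
    ∃ X : Set ℕ, HighForTightDS X ∧ ¬ UnifHighForTightDS X := by
  obtain ⟨L, hL, hsurj⟩ := exists_enumeration_computableLinOrd
  obtain ⟨X, hX, hcode, hW⟩ := exists_generic_set hL
  exact ⟨X, highForTightDS_of_coded hsurj hX hcode, not_unifHighForTightDS hW⟩

end CFT
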